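/- arXiv:1202.0578 — 5 statements merged into one kernel-verified Lean document; each statement's English description precedes it below -/
import Mathlib

section
/- For every integer m ≥ 1, the subgroup of the unit quaternions generated by a = cos(π/m) + sin(π/m)·i and j is isomorphic to the dicyclic (generalized quaternion) group of order 4m; in particular it is a finite group of order 4m, and it satisfies the relations a^m = −1 = j², j a j⁻¹ = a⁻¹. -/
open Quaternion Metric

namespace QuaternionGroup

variable {G : Type*} [Group G] {n : ℕ}

/-- The homomorphism `i ↦ g ^ i` on `ZMod k` attached to an element with `g ^ k = 1`. -/
def zmodPow {k : ℕ} (g : G) (hg : g ^ k = 1) : ZMod k →+ Additive G :=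
  ZMod.lift k ⟨zmultiplesHom (Additive G) (Additive.ofMul g), by
    simp [← ofMul_pow, hg]⟩

theorem toMul_zmodPow_intCast {k : ℕ} (g : G) (hg : g ^ k = 1) (i : ℤ) :
    (zmodPow g hg (i : ZMod k)).toMul = g ^ i := by
  simp [zmodPow]

/-- The homomorphism out of the dicyclic group given by a pair satisfying its relations. -/
def lift (g x : G) (hg : g ^ (2 * n) = 1) (hx : x ^ 2 = g ^ n) (hgx : x * g * x⁻¹ = g⁻¹) :
    QuaternionGroup n →* G :=
  MonoidHom.mk'
    (fun
      | a i => (zmodPow g hg i).toMul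
      | xa i => x * (zmodPow g hg i).toMul) <| by
    have hcomm (i : ℤ) : g ^ i * x = x * g ^ (-i) := by
      have h : SemiconjBy x g g⁻¹ := mul_inv_eq_iff_eq_mul.mp hgx
      simpa using (h.zpow_right (-i)).eq.symm
    rintro (i | i) (j | j) <;>
      obtain ⟨i, rfl⟩ := ZMod.intCast_surjective i <;>
      obtain ⟨j, rfl⟩ := ZMod.intCast_surjective j
    · simp
    · simp only [a_mul_xa, ← Int.cast_sub, toMul_zmodPow_intCast]
      rw [← mul_assoc, hcomm, mul_assoc, ← zpow_add, neg_add_eq_sub]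
    · simp [mul_assoc]
    · have h : ((n : ZMod (2 * n)) + j - i) = ((n + j - i : ℤ) : ZMod (2 * n)) := by
        push_cast; rfl
      simp only [xa_mul_xa, h, toMul_zmodPow_intCast]
      rw [mul_assoc, ← mul_assoc (g ^ i), hcomm, mul_assoc, ← mul_assoc x x, ← sq, hx,
        ← zpow_natCast, ← zpow_add, ← zpow_add]
      congr 1
      ring

theorem lift_a_intCast (g x : G) (hg : g ^ (2 * n) = 1) (hx : x ^ 2 = g ^ n)
    (hgx : x * g * x⁻¹ = g⁻¹) (i : ℤ) : lift g x hg hx hgx (a i) = g ^ i :=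
  toMul_zmodPow_intCast g hg i

theorem lift_xa_intCast (g x : G) (hg : g ^ (2 * n) = 1) (hx : x ^ 2 = g ^ n)
    (hgx : x * g * x⁻¹ = g⁻¹) (i : ℤ) : lift g x hg hx hgx (xa i) = x * g ^ i :=
  congrArg (x * ·) (toMul_zmodPow_intCast g hg i)

theorem range_lift (g x : G) (hg : g ^ (2 * n) = 1) (hx : x ^ 2 = g ^ n)
    (hgx : x * g * x⁻¹ = g⁻¹) : (lift g x hg hx hgx).range = Subgroup.closure {g, x} := by
  have hg_mem : g ∈ Subgroup.closure {g, x} := Subgroup.subset_closure (by simp)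
  have hx_mem : x ∈ Subgroup.closure {g, x} := Subgroup.subset_closure (by simp)
  apply le_antisymm
  · rintro _ ⟨i | i, rfl⟩ <;> obtain ⟨i, rfl⟩ := ZMod.intCast_surjective i
    · rw [lift_a_intCast]
      exact zpow_mem hg_mem i
    · rw [lift_xa_intCast]
      exact mul_mem hx_mem (zpow_mem hg_mem i)
  · rw [Subgroup.closure_le]
    rintro _ (rfl | rfl)
    · exact ⟨a (1 : ℤ), by rw [lift_a_intCast, zpow_one]⟩
    · exact ⟨xa (0 : ℤ), by rw [lift_xa_intCast, zpow_zero, mul_one]⟩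

theorem lift_injective (g x : G) (hg : g ^ (2 * n) = 1) (hx : x ^ 2 = g ^ n)
    (hgx : x * g * x⁻¹ = g⁻¹) (ho : orderOf g = 2 * n) (hxg : x ∉ Subgroup.zpowers g) :
    Function.Injective (lift g x hg hx hgx) := by
  rw [injective_iff_map_eq_one]
  rintro (i | i) h <;> obtain ⟨i, rfl⟩ := ZMod.intCast_surjective i
  · rw [lift_a_intCast, ← orderOf_dvd_iff_zpow_eq_one, ho] at h
    rw [(ZMod.intCast_zmod_eq_zero_iff_dvd i (2 * n)).mpr h, a_zero]
  · rw [lift_xa_intCast, mul_eq_one_iff_eq_inv, ← zpow_neg] at h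
    exact absurd ⟨-i, h.symm⟩ hxg

/-- A pair satisfying the dicyclic relations faithfully generates a dicyclic group. -/
noncomputable def closureEquiv (g x : G) (hx : x ^ 2 = g ^ n)
    (hgx : x * g * x⁻¹ = g⁻¹) (ho : orderOf g = 2 * n) (hxg : x ∉ Subgroup.zpowers g) :
    Subgroup.closure {g, x} ≃* QuaternionGroup n :=
  have hg : g ^ (2 * n) = 1 := ho ▸ pow_orderOf_eq_one g
  (MulEquiv.subgroupCongr (range_lift g x hg hx hgx).symm).trans
    (MonoidHom.ofInjective (lift_injective g x hg hx hgx ho hxg)).symm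

end QuaternionGroup

theorem Quaternion.pow_eq_mk_cos_sin {q : ℍ[ℝ]} {θ : ℝ}
    (hq : q = ⟨Real.cos θ, Real.sin θ, 0, 0⟩) (k : ℕ) :
    q ^ k = ⟨Real.cos (k * θ), Real.sin (k * θ), 0, 0⟩ := by
  obtain ⟨h₀, h₁, h₂, h₃⟩ := QuaternionAlgebra.ext_iff.mp hq
  dsimp only at h₀ h₁ h₂ h₃
  induction k with
  | zero => ext <;> simp
  | succ k ih =>
    obtain ⟨i₀, i₁, i₂, i₃⟩ := QuaternionAlgebra.ext_iff.mp ih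
    dsimp only at i₀ i₁ i₂ i₃
    push_cast
    rw [pow_succ, add_one_mul, Real.cos_add, Real.sin_add]
    ext <;> simp [h₀, h₁, h₂, h₃, i₀, i₁, i₂, i₃, add_comm]

theorem Quaternion.orderOf_eq_two_mul_of_eq_mk_cos_sin {q : ℍ[ℝ]} {m : ℕ} (hm : 1 ≤ m)
    (hq : q = ⟨Real.cos (Real.pi / m), Real.sin (Real.pi / m), 0, 0⟩) :
    orderOf q = 2 * m := by
  have hm0 : (m : ℝ) ≠ 0 := by positivity
  apply Nat.dvd_antisymm
  · rw [orderOf_dvd_iff_pow_eq_one, pow_eq_mk_cos_sin hq]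
    have h : ((2 * m : ℕ) : ℝ) * (Real.pi / m) = 2 * Real.pi := by
      push_cast
      field_simp
    rw [h]
    ext <;> simp
  · have h := (pow_eq_mk_cos_sin hq _).symm.trans (pow_orderOf_eq_one q)
    obtain ⟨l, hl⟩ := (Real.cos_eq_one_iff _).mp (congrArg QuaternionAlgebra.re h)
    have hl' : (l : ℝ) * (2 * m) = orderOf q := by
      have := Real.pi_ne_zero
      field_simp at hl
      linarith
    have : l * (2 * m) = (orderOf q : ℤ) := by exact_mod_cast hl'
    exact_mod_cast (Dvd.intro_left l this : (2 * m : ℤ) ∣ orderOf q)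

/-- For every `m ≥ 1`, the subgroup of the unit quaternions generated by
`a = cos(π/m) + sin(π/m)·i` and `j` is isomorphic to the dicyclic (generalized
quaternion) group of order `4m`; in particular it is finite of order `4m`, and
satisfies `a^m = -1 = j²` and `j a j⁻¹ = a⁻¹`. -/
theorem binary_dihedral_subgroup_of_unit_quaternions (m : ℕ) (hm : 1 ≤ m)
    (a j : sphere (0 : ℍ[ℝ]) 1)
    (ha : (a : ℍ[ℝ]) = ⟨Real.cos (Real.pi / m), Real.sin (Real.pi / m), 0, 0⟩)
    (hj : (j : ℍ[ℝ]) = ⟨0, 0, 1, 0⟩) :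
    Nonempty (Subgroup.closure {a, j} ≃* QuaternionGroup m) ∧
    Nat.card (Subgroup.closure {a, j}) = 4 * m ∧
    (a : ℍ[ℝ]) ^ m = -1 ∧ (j : ℍ[ℝ]) ^ 2 = -1 ∧
    (j : ℍ[ℝ]) * (a : ℍ[ℝ]) * (j : ℍ[ℝ])⁻¹ = ((a : ℍ[ℝ]))⁻¹ := by
  have hm0 : (m : ℝ) ≠ 0 := by positivity
  have : NeZero m := ⟨by lia⟩
  obtain ⟨a₀, a₁, a₂, a₃⟩ := QuaternionAlgebra.ext_iff.mp ha
  obtain ⟨j₀, j₁, j₂, j₃⟩ := QuaternionAlgebra.ext_iff.mp hj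
  dsimp only at a₀ a₁ a₂ a₃ j₀ j₁ j₂ j₃
  have ham : (a : ℍ[ℝ]) ^ m = -1 := by
    rw [Quaternion.pow_eq_mk_cos_sin ha, mul_div_cancel₀ _ hm0]
    ext <;> simp
  have hj2 : (j : ℍ[ℝ]) ^ 2 = -1 := by
    rw [sq]
    ext <;> simp [j₀, j₁, j₂, j₃]
  have ha0 : (a : ℍ[ℝ]) ≠ 0 := ne_zero_of_mem_unit_sphere a
  have hj0 : (j : ℍ[ℝ]) ≠ 0 := ne_zero_of_mem_unit_sphere j
  have haja : (a : ℍ[ℝ]) * j * a = j := by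
    ext <;> simp [a₀, a₁, a₂, a₃, j₀, j₁, j₂, j₃]
    · linarith [Real.sin_sq_add_cos_sq (Real.pi / m)]
    · ring
  have hconj : (j : ℍ[ℝ]) * a * (j : ℍ[ℝ])⁻¹ = (a : ℍ[ℝ])⁻¹ := by
    rw [mul_inv_eq_iff_eq_mul₀ hj0, eq_inv_mul_iff_mul_eq₀ ha0, ← mul_assoc, haja]
  have ho : orderOf a = 2 * m := by
    rw [← Quaternion.orderOf_eq_two_mul_of_eq_mk_cos_sin hm ha]
    exact (orderOf_injective (Submonoid.unitSphere ℍ[ℝ]).subtype Subtype.val_injective a).symm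
  have hja : j ∉ Subgroup.zpowers a := by
    have hfin : IsOfFinOrder a := orderOf_pos_iff.mp (by lia)
    rw [← hfin.mem_powers_iff_mem_zpowers]
    rintro ⟨k, hk⟩
    have h : (a : ℍ[ℝ]) ^ k = j := by exact_mod_cast congrArg Subtype.val hk
    have hJ := congrArg QuaternionAlgebra.imJ ((Quaternion.pow_eq_mk_cos_sin ha k).symm.trans h)
    simp [j₂] at hJ
  let e := QuaternionGroup.closureEquiv (n := m) a j
    (Subtype.ext (by push_cast; rw [hj2, ham])) (Subtype.ext (by push_cast; exact hconj)) ho hja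
  refine ⟨⟨e⟩, ?_, ham, hj2, hconj⟩
  rw [Nat.card_congr e.toEquiv, Nat.card_eq_fintype_card, QuaternionGroup.card]
end

section
/- The 48-element set of quaternions consisting of the binary tetrahedral group 𝕋* = {±1, ±i, ±j, ±k} ∪ {(±1 ± i ± j ± k)/2} together with the 24 quaternions (±u ± v)/√2 for distinct u, v ∈ {1, i, j, k} is a subgroup of the group of unit quaternions of order 48 (the binary octahedral group 𝕆*), and there is a surjective group homomorphism from 𝕆* onto the symmetric group S₄ on 4 letters with kernel {1, −1}; that is, 𝕆* is a double cover of S₄. -/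
open Quaternion Metric

/-- The 24-element set `{±1, ±i, ±j, ±k} ∪ {(±1 ± i ± j ± k)/2}`: the binary
tetrahedral group `𝕋*`. -/
def binaryTetrahedral : Set ℍ[ℝ] :=
  {q | (∃ ε : ℝ, (ε = 1 ∨ ε = -1) ∧
          (q = ⟨ε, 0, 0, 0⟩ ∨ q = ⟨0, ε, 0, 0⟩ ∨ q = ⟨0, 0, ε, 0⟩ ∨ q = ⟨0, 0, 0, ε⟩)) ∨
       (∃ a b c d : ℝ,
          (a = 1/2 ∨ a = -(1/2)) ∧ (b = 1/2 ∨ b = -(1/2)) ∧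
          (c = 1/2 ∨ c = -(1/2)) ∧ (d = 1/2 ∨ d = -(1/2)) ∧ q = ⟨a, b, c, d⟩)}

/-- The 24 quaternions `(±u ± v)/√2` for distinct `u, v ∈ {1, i, j, k}`. -/
def octahedralExtra : Set ℍ[ℝ] :=
  {q | ∃ a b : ℝ,
        (a = 1 / Real.sqrt 2 ∨ a = -(1 / Real.sqrt 2)) ∧
        (b = 1 / Real.sqrt 2 ∨ b = -(1 / Real.sqrt 2)) ∧
        ∃ u ∈ ({⟨1, 0, 0, 0⟩, ⟨0, 1, 0, 0⟩, ⟨0, 0, 1, 0⟩, ⟨0, 0, 0, 1⟩} : Set ℍ[ℝ]),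
        ∃ v ∈ ({⟨1, 0, 0, 0⟩, ⟨0, 1, 0, 0⟩, ⟨0, 0, 1, 0⟩, ⟨0, 0, 0, 1⟩} : Set ℍ[ℝ]),
          u ≠ v ∧ q = a • u + b • v}

/-- The binary octahedral group `𝕆*`: `𝕋*` together with `(±u ± v)/√2` for distinct
`u, v ∈ {1, i, j, k}`. -/
def binaryOctahedral : Set ℍ[ℝ] := binaryTetrahedral ∪ octahedralExtra

set_option maxRecDepth 100000

/-- Quaternions over a commutative ring, with the constants of `ℍ[R]` coming from the ring
structure. -/
abbrev CommRingQuaternion (R : Type*) [CommRing R] := ℍ[R]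

/-- Quaternions over `ℤ[√2]`. -/
abbrev ZsqrtTwoQuaternion := CommRingQuaternion (ℤ√2)

instance quaternionDecidableEq {R : Type*} [CommRing R] [DecidableEq R] :
    DecidableEq (CommRingQuaternion R) :=
  fun _ _ => decidable_of_iff' _ QuaternionAlgebra.ext_iff

/-- The quaternions `1, i, j, k`. -/
def quaternionUnits (R : Type*) [CommRing R] : Fin 4 → ℍ[R] :=
  ![⟨1, 0, 0, 0⟩, ⟨0, 1, 0, 0⟩, ⟨0, 0, 1, 0⟩, ⟨0, 0, 0, 1⟩]

/-- The elements `1` and `-1` of `ℤ[√2]`. -/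
def signs : Finset (ℤ√2) := {1, -1}

/-- The elements `2 * q` for `q ∈ 𝕆*`, as quaternions over `ℤ[√2]`. -/
def doubledOctahedral : Finset ZsqrtTwoQuaternion :=
  (signs ×ˢ Finset.univ).image (fun p => (2 * p.1) • quaternionUnits (ℤ√2) p.2) ∪
  (signs ×ˢ signs ×ˢ signs ×ˢ signs).image
    (fun p => ⟨p.1, p.2.1, p.2.2.1, p.2.2.2⟩) ∪
  (signs ×ˢ signs ×ˢ Finset.univ.offDiag).image
    (fun p => (Zsqrtd.sqrtd * p.1) • quaternionUnits (ℤ√2) p.2.2.1 +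
      (Zsqrtd.sqrtd * p.2.1) • quaternionUnits (ℤ√2) p.2.2.2)

/-- Vectors spanning the four body diagonals of the cube. -/
def diagonal : Fin 4 → ZsqrtTwoQuaternion :=
  ![⟨0, 1, 1, 1⟩, ⟨0, 1, -1, -1⟩, ⟨0, -1, 1, -1⟩, ⟨0, -1, -1, 1⟩]

/-- Conjugation by `x` permutes the elements `d n` according to `σ`, up to sign. -/
def PermutesUpToSign {A ι : Type*} [Ring A] (d : ι → A) (x : A) (σ : Equiv.Perm ι) : Prop :=
  ∀ n, x * d n = d (σ n) * x ∨ x * d n = -(d (σ n) * x)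

namespace PermutesUpToSign

variable {A B ι : Type*} [Ring A] [Ring B] {d : ι → A} {x y : A} {σ τ : Equiv.Perm ι}

instance [Fintype ι] [DecidableEq A] : Decidable (PermutesUpToSign d x σ) :=
  inferInstanceAs (Decidable (∀ _, _))

theorem mul (hx : PermutesUpToSign d x σ) (hy : PermutesUpToSign d y τ) :
    PermutesUpToSign d (x * y) (σ * τ) := by
  intro n
  rw [Equiv.Perm.mul_apply]
  rcases hy n with hy | hy <;> rcases hx (τ n) with hx | hx
  · left; rw [mul_assoc, hy, ← mul_assoc, hx, mul_assoc]
  · right; rw [mul_assoc, hy, ← mul_assoc, hx, neg_mul, mul_assoc]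
  · right; rw [mul_assoc, hy, mul_neg, ← mul_assoc, hx, mul_assoc]
  · left; rw [mul_assoc, hy, mul_neg, ← mul_assoc, hx, neg_mul, neg_neg, mul_assoc]

theorem smul {R : Type*} [CommRing R] [Algebra R A] (c : R) (hx : PermutesUpToSign d x σ) :
    PermutesUpToSign d (c • x) σ := fun n => by
  rw [smul_mul_assoc, mul_smul_comm, ← smul_neg]
  exact (hx n).imp (congrArg (c • ·)) (congrArg (c • ·))

theorem map_iff {f : A →+* B} (hf : Function.Injective f) :
    PermutesUpToSign (f ∘ d) (f x) σ ↔ PermutesUpToSign d x σ := by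
  simp only [PermutesUpToSign, Function.comp_apply, ← map_mul, ← map_neg, hf.eq_iff]

theorem unique [IsDomain A] (hd : ∀ m n, d m = d n ∨ d m = -d n → m = n) (hx0 : x ≠ 0)
    (hσ : PermutesUpToSign d x σ) (hτ : PermutesUpToSign d x τ) : σ = τ := by
  ext1 n
  apply hd
  rcases hσ n with h | h <;> rcases hτ n with h' | h' <;> rw [h] at h'
  · exact Or.inl (mul_right_cancel₀ hx0 h')
  · exact Or.inr (mul_right_cancel₀ hx0 (by rw [h', neg_mul]))
  · exact Or.inr (mul_right_cancel₀ hx0 (by rw [neg_mul, ← h', neg_neg]))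
  · exact Or.inl (mul_right_cancel₀ hx0 (neg_injective h'))

theorem one : PermutesUpToSign d 1 1 := fun n => Or.inl (by simp)

theorem neg (hx : PermutesUpToSign d x σ) : PermutesUpToSign d (-x) σ := fun n => by
  simpa only [neg_mul, mul_neg, neg_inj] using hx n

end PermutesUpToSign

theorem card_doubledOctahedral : doubledOctahedral.card = 48 := by
  decide +kernel

theorem exists_mul_eq_two_mul : ∀ x ∈ doubledOctahedral, ∀ y ∈ doubledOctahedral,
    ∃ z ∈ doubledOctahedral, x * y = 2 * z := by
  decide +kernel

theorem star_mem_doubledOctahedral : ∀ x ∈ doubledOctahedral, star x ∈ doubledOctahedral := by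
  decide +kernel

theorem mul_star_doubledOctahedral : ∀ x ∈ doubledOctahedral, x * star x = 4 := by
  decide +kernel

theorem exists_permutesUpToSign :
    ∀ x ∈ doubledOctahedral, ∃ σ : Equiv.Perm (Fin 4), PermutesUpToSign diagonal x σ := by
  decide +kernel

theorem exists_mem_permutesUpToSign :
    ∀ σ : Equiv.Perm (Fin 4), ∃ x ∈ doubledOctahedral, PermutesUpToSign diagonal x σ := by
  decide +kernel

theorem eq_two_or_eq_neg_two_of_permutesUpToSign_one :
    ∀ x ∈ doubledOctahedral, PermutesUpToSign diagonal x 1 → x = 2 ∨ x = -2 := by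
  decide +kernel

theorem eq_of_diagonal_eq_or_neg :
    ∀ m n, diagonal m = diagonal n ∨ diagonal m = -diagonal n → m = n := by
  decide +kernel

/-- The embedding of `ℤ[√2]` in `ℝ`. -/
noncomputable def zsqrtTwoToReal : ℤ√2 →+* ℝ :=
  Zsqrtd.lift ⟨√2, by norm_num⟩

theorem zsqrtTwoToReal_injective : Function.Injective zsqrtTwoToReal := by
  refine Zsqrtd.lift_injective _ fun n hn => ?_
  have : n.natAbs * n.natAbs = 2 := by zify; simpa using hn.symm
  have h : n.natAbs < 2 := by nlinarith
  interval_cases n.natAbs <;> omega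

@[simp] theorem zsqrtTwoToReal_sqrtd : zsqrtTwoToReal Zsqrtd.sqrtd = √2 := by
  simp [zsqrtTwoToReal]

section

variable {R S : Type*} [CommRing R] [CommRing S] (f : R →+* S) (x y : ℍ[R])

/-- A ring homomorphism applied to the coefficients of a quaternion. -/
def mapCoefficients : ℍ[S] := ⟨f x.re, f x.imI, f x.imJ, f x.imK⟩

@[simp] theorem re_mapCoefficients : (mapCoefficients f x).re = f x.re := rfl

@[simp] theorem imI_mapCoefficients : (mapCoefficients f x).imI = f x.imI := rfl

@[simp] theorem imJ_mapCoefficients : (mapCoefficients f x).imJ = f x.imJ := rfl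

@[simp] theorem imK_mapCoefficients : (mapCoefficients f x).imK = f x.imK := rfl

/-- The ring homomorphism between quaternion rings induced by one on coefficients. -/
def quaternionMap : ℍ[R] →+* ℍ[S] where
  toFun := mapCoefficients f
  map_one' := by ext <;> simp
  map_zero' := by ext <;> simp
  map_mul' x y := by ext <;> simp
  map_add' x y := by ext <;> simp

@[simp] theorem re_quaternionMap : (quaternionMap f x).re = f x.re := rfl

@[simp] theorem imI_quaternionMap : (quaternionMap f x).imI = f x.imI := rfl

@[simp] theorem imJ_quaternionMap : (quaternionMap f x).imJ = f x.imJ := rfl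

@[simp] theorem imK_quaternionMap : (quaternionMap f x).imK = f x.imK := rfl

theorem quaternionMap_quaternionUnits (n : Fin 4) :
    quaternionMap f (quaternionUnits R n) = quaternionUnits S n := by
  fin_cases n <;> ext <;> first | exact f.map_one | exact f.map_zero

theorem quaternionMap_smul (a : R) : quaternionMap f (a • x) = f a • quaternionMap f x := by
  ext <;> simp

theorem quaternionMap_star : quaternionMap f (star x) = star (quaternionMap f x) := by
  ext <;> simp

end

theorem quaternionMap_injective {R S : Type*} [CommRing R] [CommRing S] {f : R →+* S}
    (hf : Function.Injective f) : Function.Injective (quaternionMap f) := by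
  intro x y h
  have h' := QuaternionAlgebra.ext_iff.1 h
  exact QuaternionAlgebra.ext (hf h'.1) (hf h'.2.1) (hf h'.2.2.1) (hf h'.2.2.2)

/-- Half of a quaternion over `ℤ[√2]`, as a real quaternion. -/
noncomputable def halve (x : ZsqrtTwoQuaternion) : ℍ[ℝ] :=
  (2⁻¹ : ℝ) • quaternionMap zsqrtTwoToReal x

theorem halve_injective : Function.Injective halve := fun _ _ h =>
  quaternionMap_injective zsqrtTwoToReal_injective
    (smul_right_injective _ (by norm_num : (2⁻¹ : ℝ) ≠ 0) h)

theorem halve_neg (x : ZsqrtTwoQuaternion) : halve (-x) = -halve x := by simp [halve]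

theorem halve_star (x : ZsqrtTwoQuaternion) : halve (star x) = star (halve x) := by
  simp [halve, quaternionMap_star]

theorem halve_two_mul (x : ZsqrtTwoQuaternion) :
    halve (2 * x) = quaternionMap zsqrtTwoToReal x := by
  rw [halve, two_mul, map_add, ← two_smul ℝ, smul_smul]
  norm_num

theorem halve_two : halve 2 = 1 := by
  simpa using halve_two_mul 1

theorem halve_mul_halve {x y z : ZsqrtTwoQuaternion} (h : x * y = 2 * z) :
    halve x * halve y = halve z := by
  rw [halve, halve, smul_mul_smul_comm, ← map_mul, h, mul_smul, ← halve, halve_two_mul, ← halve]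

theorem quaternionUnits_injective : Function.Injective (quaternionUnits ℝ) := by
  have h : Function.Injective (quaternionUnits (ℤ√2)) := by decide +kernel
  rw [show quaternionUnits ℝ = quaternionMap zsqrtTwoToReal ∘ quaternionUnits (ℤ√2) from
    funext fun n => (quaternionMap_quaternionUnits _ n).symm]
  exact (quaternionMap_injective zsqrtTwoToReal_injective).comp h

theorem mem_quaternionUnits_iff (u : ℍ[ℝ]) :
    u ∈ ({⟨1, 0, 0, 0⟩, ⟨0, 1, 0, 0⟩, ⟨0, 0, 1, 0⟩, ⟨0, 0, 0, 1⟩} : Set ℍ[ℝ]) ↔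
      ∃ n, quaternionUnits ℝ n = u := by
  constructor
  · rintro (rfl | rfl | rfl | rfl)
    exacts [⟨0, rfl⟩, ⟨1, rfl⟩, ⟨2, rfl⟩, ⟨3, rfl⟩]
  · rintro ⟨n, rfl⟩
    fin_cases n
    exacts [.inl rfl, .inr (.inl rfl), .inr (.inr (.inl rfl)), .inr (.inr (.inr rfl))]

theorem eq_smul_quaternionUnits_iff (ε : ℝ) (q : ℍ[ℝ]) :
    (q = ⟨ε, 0, 0, 0⟩ ∨ q = ⟨0, ε, 0, 0⟩ ∨ q = ⟨0, 0, ε, 0⟩ ∨ q = ⟨0, 0, 0, ε⟩) ↔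
      ∃ n, ε • quaternionUnits ℝ n = q := by
  have h0 : ε • quaternionUnits ℝ 0 = ⟨ε, 0, 0, 0⟩ := by
    ext
    exacts [mul_one ε, mul_zero ε, mul_zero ε, mul_zero ε]
  have h1 : ε • quaternionUnits ℝ 1 = ⟨0, ε, 0, 0⟩ := by
    ext
    exacts [mul_zero ε, mul_one ε, mul_zero ε, mul_zero ε]
  have h2 : ε • quaternionUnits ℝ 2 = ⟨0, 0, ε, 0⟩ := by
    ext
    exacts [mul_zero ε, mul_zero ε, mul_one ε, mul_zero ε]
  have h3 : ε • quaternionUnits ℝ 3 = ⟨0, 0, 0, ε⟩ := by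
    ext
    exacts [mul_zero ε, mul_zero ε, mul_zero ε, mul_one ε]
  rw [← h0, ← h1, ← h2, ← h3]
  simp only [Fin.exists_fin_succ, Fin.exists_fin_zero, or_false, eq_comm (a := q)]
  rfl

theorem eq_or_eq_neg_iff (a c : ℝ) :
    (a = c ∨ a = -c) ↔ ∃ s ∈ signs, a = c * zsqrtTwoToReal s := by
  simp [signs]

theorem mem_doubledOctahedral_iff (x : ZsqrtTwoQuaternion) :
    x ∈ doubledOctahedral ↔
      ((∃ s ∈ signs, ∃ n, (2 * s) • quaternionUnits (ℤ√2) n = x) ∨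
      (∃ a ∈ signs, ∃ b ∈ signs, ∃ c ∈ signs, ∃ d ∈ signs,
        (⟨a, b, c, d⟩ : ZsqrtTwoQuaternion) = x)) ∨
      (∃ a ∈ signs, ∃ b ∈ signs, ∃ m n, m ≠ n ∧
        (Zsqrtd.sqrtd * a) • quaternionUnits (ℤ√2) m +
          (Zsqrtd.sqrtd * b) • quaternionUnits (ℤ√2) n = x) := by
  rw [doubledOctahedral, Finset.mem_union, Finset.mem_union]
  refine (or_congr (or_congr Finset.mem_image Finset.mem_image) Finset.mem_image).trans ?_
  simp only [Finset.mem_product, Finset.mem_offDiag, Finset.mem_univ, true_and,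
    and_true, Prod.exists, and_assoc,
    exists_and_left]
  rfl

theorem one_div_sqrt_two : (1 / √2 : ℝ) = 2⁻¹ * √2 := by
  have := Real.mul_self_sqrt (zero_le_two (α := ℝ))
  field_simp
  linarith

theorem halve_two_mul_smul_quaternionUnits (s : ℤ√2) (n : Fin 4) :
    halve ((2 * s) • quaternionUnits (ℤ√2) n) = zsqrtTwoToReal s • quaternionUnits ℝ n := by
  rw [halve, quaternionMap_smul, quaternionMap_quaternionUnits, smul_smul, map_mul, map_ofNat,
    inv_mul_cancel_left₀ two_ne_zero]

theorem halve_sqrtd_smul_add (a b : ℤ√2) (m n : Fin 4) :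
    halve ((Zsqrtd.sqrtd * a) • quaternionUnits (ℤ√2) m +
      (Zsqrtd.sqrtd * b) • quaternionUnits (ℤ√2) n) =
    (1 / √2 * zsqrtTwoToReal a) • quaternionUnits ℝ m +
      (1 / √2 * zsqrtTwoToReal b) • quaternionUnits ℝ n := by
  rw [halve, map_add, quaternionMap_smul, quaternionMap_smul, quaternionMap_quaternionUnits,
    quaternionMap_quaternionUnits, smul_add, smul_smul, smul_smul, map_mul, map_mul,
    zsqrtTwoToReal_sqrtd, one_div_sqrt_two, mul_assoc, mul_assoc]

theorem halve_mk_eq (a b c d : ℤ√2) :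
    halve (⟨a, b, c, d⟩ : ZsqrtTwoQuaternion) = ⟨1 / 2 * zsqrtTwoToReal a,
      1 / 2 * zsqrtTwoToReal b, 1 / 2 * zsqrtTwoToReal c, 1 / 2 * zsqrtTwoToReal d⟩ := by
  rw [one_div]
  rfl

theorem mem_binaryOctahedral_iff (q : ℍ[ℝ]) :
    q ∈ binaryOctahedral ↔ ∃ x ∈ doubledOctahedral, halve x = q := by
  simp only [mem_doubledOctahedral_iff]
  constructor
  · rintro ((⟨ε, hε, h⟩ | ⟨a, b, c, d, ha, hb, hc, hd, rfl⟩) |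
      ⟨a, b, ha, hb, u, hu, v, hv, huv, rfl⟩)
    · obtain ⟨s, hs, rfl⟩ := (eq_or_eq_neg_iff _ _).1 hε
      obtain ⟨n, rfl⟩ := (eq_smul_quaternionUnits_iff _ _).1 h
      exact ⟨_, .inl (.inl ⟨s, hs, n, rfl⟩), by
        rw [halve_two_mul_smul_quaternionUnits, one_mul]⟩
    · obtain ⟨a, ha', rfl⟩ := (eq_or_eq_neg_iff _ _).1 ha
      obtain ⟨b, hb', rfl⟩ := (eq_or_eq_neg_iff _ _).1 hb
      obtain ⟨c, hc', rfl⟩ := (eq_or_eq_neg_iff _ _).1 hc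
      obtain ⟨d, hd', rfl⟩ := (eq_or_eq_neg_iff _ _).1 hd
      exact ⟨_, .inl (.inr ⟨a, ha', b, hb', c, hc', d, hd', rfl⟩), halve_mk_eq a b c d⟩
    · obtain ⟨a, ha', rfl⟩ := (eq_or_eq_neg_iff _ _).1 ha
      obtain ⟨b, hb', rfl⟩ := (eq_or_eq_neg_iff _ _).1 hb
      obtain ⟨m, rfl⟩ := (mem_quaternionUnits_iff _).1 hu
      obtain ⟨n, rfl⟩ := (mem_quaternionUnits_iff _).1 hv
      exact ⟨_, .inr ⟨a, ha', b, hb', m, n, ne_of_apply_ne _ huv, rfl⟩,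
        halve_sqrtd_smul_add a b m n⟩
  · rintro ⟨x, (⟨s, hs, n, rfl⟩ | ⟨a, ha, b, hb, c, hc, d, hd, rfl⟩) |
      ⟨a, ha, b, hb, m, n, hmn, rfl⟩, rfl⟩
    · refine .inl (.inl ⟨_, (eq_or_eq_neg_iff _ _).2 ⟨s, hs, rfl⟩,
        (eq_smul_quaternionUnits_iff _ _).2 ⟨n, ?_⟩⟩)
      rw [halve_two_mul_smul_quaternionUnits, one_mul]
    · exact .inl (.inr ⟨_, _, _, _, (eq_or_eq_neg_iff _ _).2 ⟨a, ha, rfl⟩,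
        (eq_or_eq_neg_iff _ _).2 ⟨b, hb, rfl⟩, (eq_or_eq_neg_iff _ _).2 ⟨c, hc, rfl⟩,
        (eq_or_eq_neg_iff _ _).2 ⟨d, hd, rfl⟩, halve_mk_eq a b c d⟩)
    · exact .inr ⟨_, _, (eq_or_eq_neg_iff _ _).2 ⟨a, ha, rfl⟩,
        (eq_or_eq_neg_iff _ _).2 ⟨b, hb, rfl⟩, _, (mem_quaternionUnits_iff _).2 ⟨m, rfl⟩,
        _, (mem_quaternionUnits_iff _).2 ⟨n, rfl⟩, quaternionUnits_injective.ne hmn,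
        halve_sqrtd_smul_add a b m n⟩

theorem norm_halve {x : ZsqrtTwoQuaternion} (hx : x ∈ doubledOctahedral) : ‖halve x‖ = 1 := by
  have h : halve x * halve (star x) = 1 := by
    rw [← halve_two]
    exact halve_mul_halve (by rw [mul_star_doubledOctahedral x hx]; norm_num)
  rw [halve_star] at h
  have h' := congrArg norm h
  rw [norm_mul, norm_star, norm_one] at h'
  nlinarith [norm_nonneg (halve x)]

/-- The body diagonals of the cube as real quaternions. -/
noncomputable def realDiagonal : Fin 4 → ℍ[ℝ] := quaternionMap zsqrtTwoToReal ∘ diagonal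

theorem eq_of_realDiagonal_eq_or_neg (m n : Fin 4)
    (h : realDiagonal m = realDiagonal n ∨ realDiagonal m = -realDiagonal n) : m = n := by
  have hf := quaternionMap_injective zsqrtTwoToReal_injective
  simp only [realDiagonal, Function.comp_apply, ← map_neg, hf.eq_iff] at h
  exact eq_of_diagonal_eq_or_neg m n h

theorem permutesUpToSign_halve_iff {x : ZsqrtTwoQuaternion} {σ : Equiv.Perm (Fin 4)} :
    PermutesUpToSign realDiagonal (halve x) σ ↔ PermutesUpToSign diagonal x σ := by
  rw [← PermutesUpToSign.map_iff (quaternionMap_injective zsqrtTwoToReal_injective)]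
  refine ⟨fun h => ?_, fun h => h.smul (2⁻¹ : ℝ)⟩
  have h' := h.smul (2 : ℝ)
  rwa [halve, smul_smul, mul_inv_cancel₀ two_ne_zero, one_smul] at h'

theorem exists_hom_perm_of_image_eq (G : Subgroup (sphere (0 : ℍ[ℝ]) 1))
    (hG : (fun g : sphere (0 : ℍ[ℝ]) 1 => (g : ℍ[ℝ])) '' (G : Set (sphere (0 : ℍ[ℝ]) 1))
      = binaryOctahedral) :
    ∃ φ : G →* Equiv.Perm (Fin 4), Function.Surjective φ ∧
      ∀ g : G, g ∈ φ.ker ↔ ((g : ℍ[ℝ]) = 1 ∨ (g : ℍ[ℝ]) = -1) := by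
  have hmem : ∀ g : G, ∃ x ∈ doubledOctahedral, halve x = (g : ℍ[ℝ]) := fun g =>
    (mem_binaryOctahedral_iff _).1 (hG ▸ Set.mem_image_of_mem _ g.2)
  have hunique : ∀ (g : G) {σ τ}, PermutesUpToSign realDiagonal (g : ℍ[ℝ]) σ →
      PermutesUpToSign realDiagonal (g : ℍ[ℝ]) τ → σ = τ := fun g _ _ =>
    PermutesUpToSign.unique eq_of_realDiagonal_eq_or_neg
      (ne_zero_of_mem_unit_sphere (g : sphere (0 : ℍ[ℝ]) 1))
  have hex : ∀ g : G, ∃ σ : Equiv.Perm (Fin 4), PermutesUpToSign realDiagonal (g : ℍ[ℝ]) σ := by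
    intro g
    obtain ⟨x, hx, hxg⟩ := hmem g
    simpa only [← hxg, permutesUpToSign_halve_iff] using exists_permutesUpToSign x hx
  choose σ hσ using hex
  refine ⟨MonoidHom.mk' σ fun g h => hunique _ (hσ _) ((hσ g).mul (hσ h)), fun τ => ?_,
    fun g => ?_⟩
  · obtain ⟨x, hx, hxτ⟩ := exists_mem_permutesUpToSign τ
    obtain ⟨g, hg, hgx⟩ := hG.ge ((mem_binaryOctahedral_iff _).2 ⟨x, hx, rfl⟩)
    refine ⟨⟨g, hg⟩, hunique ⟨g, hg⟩ (hσ _) ?_⟩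
    have h := permutesUpToSign_halve_iff.2 hxτ
    rwa [← show ((g : sphere (0 : ℍ[ℝ]) 1) : ℍ[ℝ]) = halve x from hgx] at h
  · rw [MonoidHom.mem_ker, MonoidHom.mk'_apply]
    constructor
    · intro h
      obtain ⟨x, hx, hxg⟩ := hmem g
      have h1 := hσ g
      rw [h, ← hxg, permutesUpToSign_halve_iff] at h1
      rw [← hxg, ← halve_two, ← halve_neg]
      exact (eq_two_or_eq_neg_two_of_permutesUpToSign_one x hx h1).imp
        (congrArg halve) (congrArg halve)
    · rintro (h | h) <;> refine hunique g (hσ g) ?_ <;> rw [h]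
      exacts [.one, PermutesUpToSign.one.neg]


/-- `𝕆*` is a subgroup of the unit quaternions of order 48, and there is a surjective
group homomorphism from `𝕆*` onto the symmetric group `S₄` with kernel `{1, −1}`:
`𝕆*` is a double cover of `S₄`. -/
theorem binaryOctahedral_is_subgroup_double_cover_S4 :
    (∀ q ∈ binaryOctahedral, ‖q‖ = 1) ∧
    (1 : ℍ[ℝ]) ∈ binaryOctahedral ∧
    (∀ q ∈ binaryOctahedral, ∀ r ∈ binaryOctahedral, q * r ∈ binaryOctahedral) ∧
    (∀ q ∈ binaryOctahedral, q⁻¹ ∈ binaryOctahedral) ∧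
    Nat.card binaryOctahedral = 48 ∧
    (∀ G : Subgroup (sphere (0 : ℍ[ℝ]) 1),
      (fun g : sphere (0 : ℍ[ℝ]) 1 => (g : ℍ[ℝ])) '' (G : Set (sphere (0 : ℍ[ℝ]) 1))
          = binaryOctahedral →
      ∃ φ : G →* Equiv.Perm (Fin 4),
        Function.Surjective φ ∧
        (∀ g : G, g ∈ φ.ker ↔ ((g : ℍ[ℝ]) = 1 ∨ (g : ℍ[ℝ]) = -1))) := by
  refine ⟨fun q hq => ?_, ?_, fun q hq r hr => ?_, fun q hq => ?_, ?_,
    exists_hom_perm_of_image_eq⟩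
  · obtain ⟨x, hx, rfl⟩ := (mem_binaryOctahedral_iff q).1 hq
    exact norm_halve hx
  · exact Or.inl (Or.inl ⟨1, Or.inl rfl, Or.inl rfl⟩)
  · obtain ⟨x, hx, rfl⟩ := (mem_binaryOctahedral_iff q).1 hq
    obtain ⟨y, hy, rfl⟩ := (mem_binaryOctahedral_iff r).1 hr
    obtain ⟨z, hz, h⟩ := exists_mul_eq_two_mul x hx y hy
    exact (mem_binaryOctahedral_iff _).2 ⟨z, hz, (halve_mul_halve h).symm⟩
  · obtain ⟨x, hx, rfl⟩ := (mem_binaryOctahedral_iff q).1 hq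
    refine (mem_binaryOctahedral_iff _).2 ⟨star x, star_mem_doubledOctahedral x hx, ?_⟩
    rw [halve_star, Quaternion.inv_def, Quaternion.normSq_eq_norm_mul_self, norm_halve hx]
    simp
  · have : binaryOctahedral = halve '' doubledOctahedral :=
      Set.ext fun q => mem_binaryOctahedral_iff q
    rw [this, Nat.card_image_of_injective halve_injective, Nat.card_coe_set_eq,
      Set.ncard_coe_finset, card_doubledOctahedral]
end

section
/- Let φ = (1+√5)/2 be the golden ratio. The subgroup of the unit quaternions generated by s = (1 + i + j + k)/2 and t = (φ + φ⁻¹·i + j)/2 is a finite group of order 120 (the binary icosahedral group 𝕀*), it contains −1, and there is a surjective group homomorphism from it onto the alternating group A₅ on 5 letters with kernel {1, −1}; that is, 𝕀* is a double cover of A₅. -/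
open Quaternion Metric

namespace BinaryIcosahedral

/-- The field `ℚ(φ)`, in which the arithmetic of the binary icosahedral group is decidable. -/
abbrev GoldenField : Type := QuadraticAlgebra ℚ 1 1

instance : DecidableEq ℍ[GoldenField] := fun _ _ => decidable_of_iff _ Quaternion.ext_iff.symm

/-- Representatives of the right cosets of `⟨b⟩` in the binary icosahedral group `⟨a, b⟩`. -/
def cosetReps {M : Type*} [Monoid M] (a b : M) : List M :=
  [1, a ^ 2 * b * a ^ 2 * b ^ 2 * a ^ 2] ++
    (List.range 5).flatMap fun j => [a * b ^ j, a ^ 2 * b * a ^ 2 * b ^ j]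

/-- Words in `a` and `b` that enumerate the binary icosahedral group `⟨a, b⟩`. -/
def words {M : Type*} [Monoid M] (a b : M) : List M :=
  (List.range 10).flatMap fun i => (cosetReps a b).map (b ^ i * ·)

section Words

variable {M N : Type*} [Monoid M] [Monoid N] {a b : M}

lemma mem_words {x : M} : x ∈ words a b ↔ ∃ i < 10, ∃ v ∈ cosetReps a b, b ^ i * v = x := by
  simp [words]

lemma map_words (f : M →* N) (a b : M) : (words a b).map f = words (f a) (f b) := by
  simp [words, cosetReps, List.map_flatMap]

lemma exists_mem_words_of_map (f : M →* N) {a' b' : N} (ha : f a = a') (hb : f b = b') {y : N}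
    (hy : y ∈ words a' b') : ∃ x ∈ words a b, f x = y := by
  subst ha hb
  rwa [← map_words, List.mem_map] at hy

lemma pow_mul_mem_words (hb : b ^ 10 = 1) {x : M} (hx : x ∈ words a b) (n : ℕ) :
    b ^ n * x ∈ words a b := by
  obtain ⟨i, -, v, hv, rfl⟩ := mem_words.1 hx
  refine mem_words.2 ⟨(n + i) % 10, Nat.mod_lt _ (by norm_num), v, hv, ?_⟩
  rw [← mul_assoc, ← pow_add, ← pow_mod_orderOf b ((n + i) % 10),
    Nat.mod_mod_of_dvd _ (orderOf_dvd_of_pow_eq_one hb), pow_mod_orderOf]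

lemma mul_mem_words (hb : b ^ 10 = 1) (hab : Commute a (b ^ 5))
    (h : ∀ i < 5, ∀ v ∈ cosetReps a b, a * (b ^ i * v) ∈ words a b)
    {x : M} (hx : x ∈ words a b) : a * x ∈ words a b := by
  obtain ⟨i, hi, v, hv, rfl⟩ := mem_words.1 hx
  rcases lt_or_ge i 5 with hi5 | hi5
  · exact h i hi5 v hv
  · obtain ⟨k, rfl⟩ := Nat.exists_eq_add_of_le hi5
    have hk := pow_mul_mem_words hb (h k (by omega) v hv) 5
    rwa [← mul_assoc, ← hab.eq, mul_assoc, ← mul_assoc (b ^ 5), ← pow_add] at hk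

lemma mem_closure_of_mem_words {G : Type*} [Group G] {a b x : G} (hx : x ∈ words a b) :
    x ∈ Subgroup.closure {a, b} := by
  have ha : a ∈ Subgroup.closure {a, b} := Subgroup.subset_closure (by simp)
  have hb : b ∈ Subgroup.closure {a, b} := Subgroup.subset_closure (by simp)
  obtain ⟨i, -, v, hv, rfl⟩ := mem_words.1 hx
  refine mul_mem (pow_mem hb i) ?_
  simp only [cosetReps, List.mem_append, List.mem_flatMap, List.mem_cons, List.not_mem_nil,
    or_false] at hv
  rcases hv with (rfl | rfl) | ⟨j, -, rfl | rfl⟩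
  · exact one_mem _
  all_goals
    repeat' first | assumption | apply pow_mem | apply mul_mem

end Words

/-- The even permutation that the first generator induces on five letters. -/
def permS : alternatingGroup (Fin 5) :=
  ⟨c[1, 4, 2], Equiv.Perm.mem_alternatingGroup.2 (by decide +kernel)⟩

/-- The even permutation that the second generator induces on five letters. -/
def permT : alternatingGroup (Fin 5) :=
  ⟨finRotate 5, Equiv.Perm.mem_alternatingGroup.2 (by decide +kernel)⟩

/-- The first generator, paired with its permutation. -/
def pairS : Equiv.Perm (Fin 5) × ℍ[GoldenField] :=
  (permS, ⟨⟨1/2, 0⟩, ⟨1/2, 0⟩, ⟨1/2, 0⟩, ⟨1/2, 0⟩⟩)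

/-- The second generator, paired with its permutation. -/
def pairT : Equiv.Perm (Fin 5) × ℍ[GoldenField] :=
  (permT, ⟨⟨0, 1/2⟩, ⟨-1/2, 1/2⟩, ⟨1/2, 0⟩, ⟨0, 0⟩⟩)

lemma pairS_pow_six : pairS ^ 6 = 1 := by decide +kernel

lemma pairT_pow_five : pairT ^ 5 = (1, -1) := by decide +kernel

lemma pairT_pow_ten : pairT ^ 10 = 1 := by decide +kernel

lemma one_mem_words : 1 ∈ words pairS pairT := by decide +kernel

lemma fst_eq_one_of_snd_eq_one : ∀ x ∈ words pairS pairT, x.2 = 1 → x.1 = 1 := by decide +kernel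

lemma snd_eq_of_fst_eq_one : ∀ x ∈ words pairS pairT, x.1 = 1 → x.2 = 1 ∨ x.2 = -1 := by
  decide +kernel

lemma mem_words_perm : ∀ g : alternatingGroup (Fin 5), g ∈ words permS permT := by
  decide +kernel

lemma pairS_mul_mem {x} (hx : x ∈ words pairS pairT) : pairS * x ∈ words pairS pairT := by
  have hcomm : pairS * pairT ^ 5 = pairT ^ 5 * pairS := by decide +kernel
  exact mul_mem_words pairT_pow_ten hcomm (by decide +kernel) hx

lemma pairS_pow_mul_mem {x} (hx : x ∈ words pairS pairT) (n : ℕ) :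
    pairS ^ n * x ∈ words pairS pairT := by
  induction n with
  | zero => simpa using hx
  | succ n ih => rw [pow_succ', mul_assoc]; exact pairS_mul_mem ih

/-- The embedding `ℚ(φ) → ℝ`. -/
noncomputable def toReal : GoldenField →ₐ[ℚ] ℝ :=
  QuadraticAlgebra.lift ⟨Real.goldenRatio, by
    rw [← sq, Real.goldenRatio_sq, one_smul, one_smul, add_comm]⟩

lemma toReal_mk (x y : ℚ) : toReal ⟨x, y⟩ = x + y * Real.goldenRatio := by
  simp [toReal, Rat.smul_def]

lemma toReal_injective : Function.Injective toReal := by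
  refine (injective_iff_map_eq_zero _).2 ?_
  rintro ⟨x, y⟩ h
  rw [toReal_mk] at h
  have hy : y = 0 := by
    by_contra hy
    refine Real.goldenRatio_irrational ⟨-x / y, ?_⟩
    have : (y : ℝ) ≠ 0 := by exact_mod_cast hy
    push_cast
    rw [div_eq_iff this]
    linarith
  subst hy
  have hx : x = 0 := by simpa using h
  subst hx
  rfl

/-- The map on quaternions induced by a ring homomorphism of the coefficients. -/
def mapQuaternion {R S : Type*} [CommRing R] [CommRing S] (f : R →+* S) : ℍ[R] →* ℍ[S] where
  toFun q := ⟨f q.re, f q.imI, f q.imJ, f q.imK⟩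
  map_one' := by ext <;> simp
  map_mul' p q := by
    refine Quaternion.ext _ _ ?_ ?_ ?_ ?_
    · simpa using (Quaternion.re_mul (R := S) ⟨_, _, _, _⟩ ⟨_, _, _, _⟩).symm
    · simpa using (Quaternion.imI_mul (R := S) ⟨_, _, _, _⟩ ⟨_, _, _, _⟩).symm
    · simpa using (Quaternion.imJ_mul (R := S) ⟨_, _, _, _⟩ ⟨_, _, _, _⟩).symm
    · simpa using (Quaternion.imK_mul (R := S) ⟨_, _, _, _⟩ ⟨_, _, _, _⟩).symm

lemma mapQuaternion_apply {R S : Type*} [CommRing R] [CommRing S] (f : R →+* S) (q : ℍ[R]) :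
    mapQuaternion f q = ⟨f q.re, f q.imI, f q.imJ, f q.imK⟩ := rfl

lemma mapQuaternion_injective {R S : Type*} [CommRing R] [CommRing S] {f : R →+* S}
    (hf : Function.Injective f) : Function.Injective (mapQuaternion f) := by
  intro p q h
  have hcoord := Quaternion.ext_iff.1 h
  exact Quaternion.ext _ _ (hf hcoord.1) (hf hcoord.2.1) (hf hcoord.2.2.1) (hf hcoord.2.2.2)

/-- The embedding of pairs over `ℚ(φ)` into pairs over `ℝ`. -/
noncomputable def modelHom :
    Equiv.Perm (Fin 5) × ℍ[GoldenField] →* Equiv.Perm (Fin 5) × ℍ[ℝ] :=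
  (MonoidHom.id _).prodMap (mapQuaternion (toReal : GoldenField →+* ℝ))

lemma modelHom_apply (x : Equiv.Perm (Fin 5) × ℍ[GoldenField]) :
    modelHom x = (x.1, mapQuaternion (toReal : GoldenField →+* ℝ) x.2) := rfl

/-- The inclusion of pairs of an even permutation and a unit quaternion in all pairs. -/
def inclHom : alternatingGroup (Fin 5) × sphere (0 : ℍ[ℝ]) 1 →* Equiv.Perm (Fin 5) × ℍ[ℝ] where
  toFun x := (x.1, x.2)
  map_one' := rfl
  map_mul' _ _ := rfl

lemma inclHom_apply (x : alternatingGroup (Fin 5) × sphere (0 : ℍ[ℝ]) 1) :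
    inclHom x = ((x.1 : Equiv.Perm (Fin 5)), (x.2 : ℍ[ℝ])) := rfl

lemma inclHom_injective : Function.Injective inclHom := fun _ _ h =>
  Prod.ext (Subtype.ext (congrArg Prod.fst h)) (Subtype.ext (congrArg Prod.snd h))

/-- A subgroup of a product whose second projection is injective is the graph of a homomorphism. -/
lemma exists_hom_of_injective_snd {A G : Type*} [Group A] [Group G] (Γ : Subgroup (A × G))
    (h : ∀ x ∈ Γ, x.2 = 1 → x.1 = 1) :
    ∃ ψ : Γ.map (MonoidHom.snd A G) →* A,
      ∀ x ∈ Γ, ∀ hx : x.2 ∈ Γ.map (MonoidHom.snd A G), ψ ⟨x.2, hx⟩ = x.1 := by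
  have hinj : Function.Injective ((MonoidHom.snd A G).subgroupMap Γ) := by
    refine (injective_iff_map_eq_one _).2 fun x hx => ?_
    have hx2 : x.1.2 = 1 := congrArg Subtype.val hx
    exact Subtype.ext (Prod.ext (h x x.2 hx2) hx2)
  let e := MulEquiv.ofBijective _ ⟨hinj, (MonoidHom.snd A G).subgroupMap_surjective Γ⟩
  refine ⟨((MonoidHom.fst A G).comp Γ.subtype).comp e.symm.toMonoidHom, fun x hxΓ hx => ?_⟩
  have : e.symm ⟨x.2, hx⟩ = ⟨x, hxΓ⟩ := e.symm_apply_eq.2 rfl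
  simp [this]

lemma inclHom_mem_of_mem_closure {a b : alternatingGroup (Fin 5) × sphere (0 : ℍ[ℝ]) 1}
    (ha : inclHom a = modelHom pairS) (hb : inclHom b = modelHom pairT)
    {x : alternatingGroup (Fin 5) × sphere (0 : ℍ[ℝ]) 1} (hx : x ∈ Subgroup.closure {a, b}) :
    ∃ w ∈ words pairS pairT, modelHom w = inclHom x := by
  have ha_inv : a⁻¹ = a ^ 5 := by
    refine inv_eq_of_mul_eq_one_right (inclHom_injective ?_)
    rw [← pow_succ', map_pow, ha, ← map_pow, pairS_pow_six, map_one, map_one]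
  have hb_inv : b⁻¹ = b ^ 9 := by
    refine inv_eq_of_mul_eq_one_right (inclHom_injective ?_)
    rw [← pow_succ', map_pow, hb, ← map_pow, pairT_pow_ten, map_one, map_one]
  have key : ∀ z ∈ ({a, b} : Set _), ∀ (n : ℕ) (y),
      (∃ w ∈ words pairS pairT, modelHom w = inclHom y) →
      ∃ w ∈ words pairS pairT, modelHom w = inclHom (z ^ n * y) := by
    rintro z (rfl | rfl) n y ⟨w, hw, hwy⟩
    · exact ⟨_, pairS_pow_mul_mem hw n, by simp [hwy, ha]⟩
    · exact ⟨_, pow_mul_mem_words pairT_pow_ten hw n, by simp [hwy, hb]⟩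
  induction hx using Subgroup.closure_induction_left with
  | one => exact ⟨1, one_mem_words, by simp⟩
  | mul_left z hz y _ ih => simpa using key z hz 1 y ih
  | inv_mul_cancel z hz y _ ih =>
    rcases id hz with rfl | rfl
    · rw [ha_inv]; exact key _ hz 5 y ih
    · rw [hb_inv]; exact key _ hz 9 y ih

end BinaryIcosahedral

open BinaryIcosahedral in
/-- With `φ = (1+√5)/2` the golden ratio, the subgroup of the unit quaternions
generated by `s = (1 + i + j + k)/2` and `t = (φ + φ⁻¹·i + j)/2` is a finite group of
order 120 (the binary icosahedral group `𝕀*`), it contains `−1`, and there is a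
surjective group homomorphism from it onto the alternating group `A₅` with kernel
`{1, −1}`: `𝕀*` is a double cover of `A₅`. -/
theorem binaryIcosahedral_order_120_double_cover_A5
    (φ : ℝ) (hφ : φ = (1 + Real.sqrt 5) / 2)
    (s t : sphere (0 : ℍ[ℝ]) 1)
    (hs : (s : ℍ[ℝ]) = ⟨1/2, 1/2, 1/2, 1/2⟩)
    (ht : (t : ℍ[ℝ]) = ⟨φ / 2, φ⁻¹ / 2, 1/2, 0⟩) :
    Nat.card (Subgroup.closure {s, t}) = 120 ∧
    (∃ g ∈ Subgroup.closure {s, t}, (g : ℍ[ℝ]) = -1) ∧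
    (∃ ψ : (Subgroup.closure {s, t}) →* alternatingGroup (Fin 5),
      Function.Surjective ψ ∧
      (∀ g : Subgroup.closure {s, t}, g ∈ ψ.ker ↔ ((g : ℍ[ℝ]) = 1 ∨ (g : ℍ[ℝ]) = -1))) := by
  obtain rfl : φ = Real.goldenRatio := hφ
  have hφ_inv : Real.goldenRatio⁻¹ = Real.goldenRatio - 1 := by
    rw [Real.inv_goldenRatio, ← Real.one_sub_goldenRatio]; ring
  have ha : inclHom (permS, s) = modelHom pairS := by
    rw [inclHom_apply, modelHom_apply, hs]
    refine Prod.ext rfl (Quaternion.ext _ _ ?_ ?_ ?_ ?_) <;>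
      change _ = toReal ⟨_, _⟩ <;> simp [toReal_mk]
  have hb : inclHom (permT, t) = modelHom pairT := by
    rw [inclHom_apply, modelHom_apply, ht, hφ_inv]
    refine Prod.ext rfl (Quaternion.ext _ _ ?_ ?_ ?_ ?_) <;>
      change _ = toReal ⟨_, _⟩ <;> rw [toReal_mk] <;> push_cast <;> ring
  set Γ := Subgroup.closure {(permS, s), (permT, t)} with hΓ
  have hH : Subgroup.closure {s, t} = Γ.map (MonoidHom.snd _ _) := by
    rw [hΓ, MonoidHom.map_closure, Set.image_pair]; rfl
  have map_eq_one {q : ℍ[GoldenField]} (h : mapQuaternion (toReal : GoldenField →+* ℝ) q = 1) :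
      q = 1 :=
    mapQuaternion_injective (f := (toReal : GoldenField →+* ℝ)) toReal_injective
      (h.trans (map_one _).symm)
  have map_neg_one : mapQuaternion (toReal : GoldenField →+* ℝ) (-1) = -1 := by
    ext <;> simp [mapQuaternion_apply]
  have fst_eq_one : ∀ x ∈ Γ, x.2 = 1 → x.1 = 1 := by
    intro x hx hx2
    obtain ⟨w, hw, hwx⟩ := inclHom_mem_of_mem_closure ha hb hx
    rw [modelHom_apply, inclHom_apply, hx2, Prod.mk.injEq] at hwx
    exact Subtype.ext (hwx.1.symm.trans (fst_eq_one_of_snd_eq_one w hw (map_eq_one hwx.2)))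
  have snd_eq : ∀ x ∈ Γ, x.1 = 1 → (x.2 : ℍ[ℝ]) = 1 ∨ (x.2 : ℍ[ℝ]) = -1 := by
    intro x hx hx1
    obtain ⟨w, hw, hwx⟩ := inclHom_mem_of_mem_closure ha hb hx
    rw [modelHom_apply, inclHom_apply, hx1, Prod.mk.injEq] at hwx
    rw [← hwx.2]
    rcases snd_eq_of_fst_eq_one w hw hwx.1 with h | h
    · exact Or.inl (by rw [h, map_one])
    · exact Or.inr (by rw [h, map_neg_one])
  obtain ⟨z, hz, hz1, hz2⟩ : ∃ z ∈ Γ, z.1 = 1 ∧ (z.2 : ℍ[ℝ]) = -1 := by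
    have h : inclHom ((permT, t) ^ 5) = (1, -1) := by
      rw [map_pow, hb, ← map_pow, pairT_pow_five, modelHom_apply, map_neg_one]
    exact ⟨(permT, t) ^ 5, pow_mem (Subgroup.subset_closure (by simp)) 5,
      Subtype.ext (congrArg Prod.fst h), congrArg Prod.snd h⟩
  obtain ⟨ψ, hψ⟩ := exists_hom_of_injective_snd Γ fst_eq_one
  rw [hH]
  have snd_mem {x} (hx : x ∈ Γ) : x.2 ∈ Γ.map (MonoidHom.snd _ _) := ⟨x, hx, rfl⟩
  have hsurj : Function.Surjective ψ := by
    intro g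
    obtain ⟨x, hx, rfl⟩ := exists_mem_words_of_map
      (MonoidHom.fst (alternatingGroup (Fin 5)) (sphere (0 : ℍ[ℝ]) 1))
      (a := (permS, s)) (b := (permT, t)) rfl rfl (mem_words_perm g)
    have hxΓ : x ∈ Γ := mem_closure_of_mem_words hx
    exact ⟨⟨x.2, snd_mem hxΓ⟩, hψ x hxΓ _⟩
  have hker : ∀ g, g ∈ ψ.ker ↔ ((g : ℍ[ℝ]) = 1 ∨ (g : ℍ[ℝ]) = -1) := by
    rintro ⟨_, x, hx, rfl⟩
    rw [MonoidHom.mem_ker]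
    refine ⟨fun h => snd_eq x hx ((hψ x hx _).symm.trans h), ?_⟩
    rintro (h | h)
    · exact (hψ x hx _).trans (fst_eq_one x hx (Subtype.ext h))
    · have hxz : x.2 = z.2 := Subtype.ext (h.trans hz2.symm)
      have := (hψ z hz (snd_mem hz)).trans hz1
      simpa only [MonoidHom.coe_snd, hxz] using this
  refine ⟨?_, ⟨z.2, snd_mem hz, hz2⟩, ψ, hsurj, hker⟩
  have hcard_ker : Nat.card ψ.ker = 2 := by
    let f : ψ.ker → ℍ[ℝ] := fun g => ((g : Γ.map (MonoidHom.snd _ _)) : sphere (0 : ℍ[ℝ]) 1)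
    have hf : Function.Injective f := fun _ _ h => Subtype.ext (Subtype.ext (Subtype.ext h))
    have hrange : Set.range f = {1, -1} := by
      ext q
      constructor
      · rintro ⟨g, rfl⟩
        exact (hker g).1 g.2
      · rintro (rfl | rfl)
        · exact ⟨1, rfl⟩
        · exact ⟨⟨⟨z.2, snd_mem hz⟩, (hker _).2 (Or.inr hz2)⟩, hz2⟩
    have hne : (1 : ℍ[ℝ]) ≠ -1 := fun h => by
      have := congrArg QuaternionAlgebra.re h
      norm_num at this
    rw [← Set.ncard_pair hne, ← hrange, Set.ncard_range_of_injective hf]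
  rw [← ψ.ker.card_mul_index, Subgroup.index_ker, MonoidHom.range_eq_top.2 hsurj, hcard_ker,
    Subgroup.card_top, nat_card_alternatingGroup]
  simp [Nat.factorial]
end

section
/- Fix n ≥ 2, let ζ = exp(2πi/(n+1)), and let γ : ℂ² → ℂ² be the real-linear map γ(z₁,z₂) = (ζz₁, ζ^{−1}z₂), the generator of the type A_n action on ℂ² ≅ ℝ⁴. Then the space of conformal Killing fields ω on Euclidean ℝ⁴ satisfying the equivariance condition ω(γx) = γ(ω(x)) for all x has dimension 5. (This is the dimension dim H⁰(ℝ⁴/Γ) = 4 + 1 for Γ of type A_n, n ≥ 2.) -/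
/-- The standard real basis `(1,0), (i,0), (0,1), (0,i)` of `ℂ² ≅ ℝ⁴`. -/
noncomputable def stdBasisC2 : Fin 4 → ℂ × ℂ :=
  ![(1, 0), (Complex.I, 0), (0, 1), (0, Complex.I)]

/-- The real coordinates of a vector in `ℂ² ≅ ℝ⁴`. -/
def coordC2 (k : Fin 4) (v : ℂ × ℂ) : ℝ :=
  ![v.1.re, v.1.im, v.2.re, v.2.im] k

/-- A conformal Killing field on Euclidean `ℝ⁴ ≅ ℂ²`: a smooth vector field
`ω` with `∂ᵢωⱼ + ∂ⱼωᵢ − (1/2)(div ω)·δᵢⱼ = 0` for all `i, j`. -/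
def IsConformalKillingC2 (ω : ℂ × ℂ → ℂ × ℂ) : Prop :=
  ContDiff ℝ (⊤ : ℕ∞) ω ∧
    ∀ (x : ℂ × ℂ) (i j : Fin 4),
      coordC2 j ((fderiv ℝ ω x) (stdBasisC2 i)) +
        coordC2 i ((fderiv ℝ ω x) (stdBasisC2 j)) =
      (1 / 2) * (∑ k : Fin 4, coordC2 k ((fderiv ℝ ω x) (stdBasisC2 k))) *
        (if i = j then 1 else 0)

open ContinuousLinearMap in
/-- The coordinate functionals of `ℂ²` as continuous linear maps. -/
noncomputable def coordC2CLM (k : Fin 4) : ℂ × ℂ →L[ℝ] ℝ :=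
  ![Complex.reCLM ∘L fst ℝ ℂ ℂ, Complex.imCLM ∘L fst ℝ ℂ ℂ,
    Complex.reCLM ∘L snd ℝ ℂ ℂ, Complex.imCLM ∘L snd ℝ ℂ ℂ] k

lemma coordC2CLM_apply (k : Fin 4) (v : ℂ × ℂ) : coordC2CLM k v = coordC2 k v := by
  fin_cases k <;> rfl

lemma ext_coordC2 {v w : ℂ × ℂ} (h : ∀ k, coordC2 k v = coordC2 k w) : v = w := by
  have h0 := h 0
  have h1 := h 1
  have h2 := h 2
  have h3 := h 3
  simp only [coordC2, Fin.isValue, Matrix.cons_val] at h0 h1 h2 h3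
  exact Prod.ext (Complex.ext h0 h1) (Complex.ext h2 h3)

lemma sum_coordC2_smul_stdBasisC2 (v : ℂ × ℂ) : ∑ k, coordC2 k v • stdBasisC2 k = v := by
  apply ext_coordC2
  intro k
  fin_cases k <;> simp [coordC2, stdBasisC2, Fin.sum_univ_four]

lemma clm_eq_zero_of_stdBasisC2 {F : Type*} [NormedAddCommGroup F] [NormedSpace ℝ F]
    {L : ℂ × ℂ →L[ℝ] F} (h : ∀ i, L (stdBasisC2 i) = 0) : L = 0 := by
  refine ContinuousLinearMap.ext fun v => ?_
  rw [← sum_coordC2_smul_stdBasisC2 v]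
  simp [h]

/-- The partial derivative of a real function on `ℂ² ≅ ℝ⁴`. -/
noncomputable def partialC2 (i : Fin 4) (f : ℂ × ℂ → ℝ) : ℂ × ℂ → ℝ :=
  fun x => fderiv ℝ f x (stdBasisC2 i)

section partialC2

variable {f g : ℂ × ℂ → ℝ}

lemma ContDiff.partialC2 (hf : ContDiff ℝ (⊤ : ℕ∞) f) (i : Fin 4) :
    ContDiff ℝ (⊤ : ℕ∞) (partialC2 i f) :=
  (hf.fderiv_right (m := (⊤ : ℕ∞)) (by simp)).clm_apply contDiff_const

lemma partialC2_comm (hf : ContDiff ℝ (⊤ : ℕ∞) f) (i j : Fin 4) :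
    partialC2 i (partialC2 j f) = partialC2 j (partialC2 i f) := by
  have hd : Differentiable ℝ (fderiv ℝ f) :=
    (hf.fderiv_right (m := (⊤ : ℕ∞)) (by simp)).differentiable (by simp)
  have key (a b : Fin 4) (x : ℂ × ℂ) : partialC2 a (partialC2 b f) x =
      fderiv ℝ (fderiv ℝ f) x (stdBasisC2 a) (stdBasisC2 b) := by
    unfold partialC2
    rw [fderiv_clm_apply (hd x) (differentiableAt_const _)]
    simp
  funext x
  rw [key, key]
  exact (hf.contDiffAt.isSymmSndFDerivAt (by
    rw [minSmoothness_of_isRCLikeNormedField]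
    exact WithTop.coe_le_coe.2 (le_top (a := (2 : ℕ∞))))).eq _ _

lemma partialC2_add (hf : ContDiff ℝ (⊤ : ℕ∞) f) (hg : ContDiff ℝ (⊤ : ℕ∞) g) (i : Fin 4) :
    partialC2 i (f + g) = partialC2 i f + partialC2 i g := by
  funext x
  simp [partialC2, fderiv_add (hf.differentiable (by simp) x) (hg.differentiable (by simp) x)]

lemma partialC2_const_smul (hf : ContDiff ℝ (⊤ : ℕ∞) f) (c : ℝ) (i : Fin 4) :
    partialC2 i (c • f) = c • partialC2 i f := by
  funext x
  simp [partialC2, fderiv_const_smul (hf.differentiable (by simp) x)]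

lemma fderiv_eq_zero_of_partialC2 (h : ∀ i, partialC2 i f = 0) (x : ℂ × ℂ) :
    fderiv ℝ f x = 0 :=
  clm_eq_zero_of_stdBasisC2 fun i => congrFun (h i) x

lemma eq_of_partialC2_eq_zero (hf : ContDiff ℝ (⊤ : ℕ∞) f) (h : ∀ i, partialC2 i f = 0)
    (x y : ℂ × ℂ) : f x = f y :=
  is_const_of_fderiv_eq_zero (hf.differentiable (by simp)) (fderiv_eq_zero_of_partialC2 h) x y

end partialC2

/-- The algebraic core of Liouville's theorem in dimension four: the Hessian of the conformal
factor of a conformal Killing field vanishes. -/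
lemma conformalFactor_hessian_eq_zero {T : Fin 4 → Fin 4 → Fin 4 → Fin 4 → ℝ}
    {P : Fin 4 → Fin 4 → ℝ} (h12 : ∀ i j k l, T i j k l = T j i k l)
    (h23 : ∀ i j k l, T i j k l = T i k j l)
    (hT : ∀ i j k l, T i j k l + T i j l k = (if k = l then 2 else 0) * P i j) (i j : Fin 4) :
    P i j = 0 := by
  have koszul (i j k l : Fin 4) : 2 * T i j k l = (if k = l then 2 else 0) * P i j +
      (if j = l then 2 else 0) * P i k - (if j = k then 2 else 0) * P i l := by
    linarith [hT i j k l, hT i k j l, hT i l j k, h23 i j k l, h23 i j l k, h23 i k l j]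
  have diag {a b : Fin 4} (hab : a ≠ b) : P a a + P b b = 0 := by
    have h1 := koszul a b a b
    have h2 := koszul b a a b
    simp only [hab, hab.symm, if_true, if_false] at h1 h2
    linarith [h12 a b a b]
  have off {a b c : Fin 4} (hab : a ≠ b) (hac : a ≠ c) (hbc : b ≠ c) : P a b = 0 := by
    have h1 := koszul a c b c
    have h2 := koszul c a b c
    simp only [hab, hac, hbc, hbc.symm, if_true, if_false] at h1 h2
    linarith [h12 a c b c]
  by_cases hij : i = j
  · subst hij
    obtain ⟨a, b, h1, h2, h3⟩ : ∃ a b : Fin 4, i ≠ a ∧ i ≠ b ∧ a ≠ b := by decide +revert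
    linarith [diag h1, diag h2, diag h3]
  · obtain ⟨c, h1, h2⟩ : ∃ c : Fin 4, i ≠ c ∧ j ≠ c := by decide +revert
    exact off hij h1 h2

lemma eq_zero_of_symm_of_antisymm {ι : Type*} {S : ι → ι → ι → ℝ}
    (hs : ∀ i j k, S i j k = S j i k) (ha : ∀ i j k, S i j k + S i k j = 0) (i j k : ι) :
    S i j k = 0 := by
  linarith [hs i j k, hs j k i, hs i k j, ha i j k, ha j k i, ha k i j]

/-- The conformal factor of a conformal Killing field, read off from the first coordinate. -/
noncomputable def conformalFactorC2 (ω : ℂ × ℂ → ℂ × ℂ) : ℂ × ℂ → ℝ :=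
  partialC2 0 (fun x => coordC2 0 (ω x))

namespace IsConformalKillingC2

variable {ω : ℂ × ℂ → ℂ × ℂ}

lemma contDiff_coord (hω : IsConformalKillingC2 ω) (k : Fin 4) :
    ContDiff ℝ (⊤ : ℕ∞) (fun x => coordC2 k (ω x)) := by
  simp only [← coordC2CLM_apply]
  exact (coordC2CLM k).contDiff.comp hω.1

lemma partialC2_coord (hω : IsConformalKillingC2 ω) (i k : Fin 4) (x : ℂ × ℂ) :
    partialC2 i (fun x => coordC2 k (ω x)) x = coordC2 k (fderiv ℝ ω x (stdBasisC2 i)) := by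
  simp only [← coordC2CLM_apply, partialC2]
  have h := (coordC2CLM k).hasFDerivAt.comp x (hω.1.differentiable (by simp) x).hasFDerivAt
  exact congrArg (fun L => L (stdBasisC2 i)) h.fderiv

lemma contDiff_conformalFactorC2 (hω : IsConformalKillingC2 ω) :
    ContDiff ℝ (⊤ : ℕ∞) (conformalFactorC2 ω) :=
  (hω.contDiff_coord 0).partialC2 0

lemma strain_apply (hω : IsConformalKillingC2 ω) (x : ℂ × ℂ) (i j : Fin 4) :
    coordC2 j (fderiv ℝ ω x (stdBasisC2 i)) + coordC2 i (fderiv ℝ ω x (stdBasisC2 j)) =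
      (if i = j then 2 else 0) * conformalFactorC2 ω x := by
  rw [conformalFactorC2, hω.partialC2_coord]
  have h := hω.2 x i j
  have h0 := hω.2 x 0 0
  by_cases hij : i = j
  · simp only [hij, if_true] at h h0 ⊢
    linarith
  · simp only [hij, if_false] at h ⊢
    linarith

lemma strain (hω : IsConformalKillingC2 ω) (i j : Fin 4) :
    partialC2 i (fun x => coordC2 j (ω x)) + partialC2 j (fun x => coordC2 i (ω x)) =
      (if i = j then (2 : ℝ) else 0) • conformalFactorC2 ω := by
  funext x
  simp only [Pi.add_apply, hω.partialC2_coord, hω.strain_apply, Pi.smul_apply, smul_eq_mul]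

lemma partialC2_strain (hω : IsConformalKillingC2 ω) (i j k : Fin 4) :
    partialC2 i (partialC2 j (fun x => coordC2 k (ω x))) +
      partialC2 i (partialC2 k (fun x => coordC2 j (ω x))) =
      (if j = k then (2 : ℝ) else 0) • partialC2 i (conformalFactorC2 ω) := by
  rw [← partialC2_const_smul hω.contDiff_conformalFactorC2, ← hω.strain,
    partialC2_add ((hω.contDiff_coord k).partialC2 j) ((hω.contDiff_coord j).partialC2 k)]

lemma partialC2_partialC2_conformalFactorC2 (hω : IsConformalKillingC2 ω) (i j : Fin 4) :
    partialC2 i (partialC2 j (conformalFactorC2 ω)) = 0 := by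
  funext x
  refine conformalFactor_hessian_eq_zero
    (T := fun i j k l => partialC2 i (partialC2 j (partialC2 k (fun x => coordC2 l (ω x)))) x)
    (P := fun i j => partialC2 i (partialC2 j (conformalFactorC2 ω)) x)
    (fun i j k l => ?_) (fun i j k l => ?_) (fun i j k l => ?_) i j
  · exact congrFun (partialC2_comm ((hω.contDiff_coord l).partialC2 k) i j) x
  · exact congrArg (fun g => partialC2 i g x) (partialC2_comm (hω.contDiff_coord l) j k)
  · have h := congrArg (fun g => partialC2 i g x) (hω.partialC2_strain j k l)
    rw [partialC2_const_smul (hω.contDiff_conformalFactorC2.partialC2 j),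
      partialC2_add (((hω.contDiff_coord l).partialC2 k).partialC2 j)
        (((hω.contDiff_coord k).partialC2 l).partialC2 j)] at h
    simpa only [Pi.add_apply, Pi.smul_apply, smul_eq_mul] using h

/-- The differential of the conformal factor is constant. -/
lemma fderiv_conformalFactorC2_eq (hω : IsConformalKillingC2 ω) (x y : ℂ × ℂ) :
    fderiv ℝ (conformalFactorC2 ω) x = fderiv ℝ (conformalFactorC2 ω) y := by
  rw [← sub_eq_zero]
  refine clm_eq_zero_of_stdBasisC2 fun i => sub_eq_zero.2 ?_
  exact eq_of_partialC2_eq_zero (hω.contDiff_conformalFactorC2.partialC2 i)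
    (fun j => hω.partialC2_partialC2_conformalFactorC2 j i) x y

/-- A conformal Killing field with constant conformal factor is affine. -/
lemma fderiv_eq (hω : IsConformalKillingC2 ω)
    (hφ : ∀ x, fderiv ℝ (conformalFactorC2 ω) x = 0) (x y : ℂ × ℂ) :
    fderiv ℝ ω x = fderiv ℝ ω y := by
  rw [← sub_eq_zero]
  refine clm_eq_zero_of_stdBasisC2 fun i => sub_eq_zero.2 (ext_coordC2 fun k => ?_)
  refine (hω.partialC2_coord i k x).symm.trans (Eq.trans ?_ (hω.partialC2_coord i k y))
  refine eq_of_partialC2_eq_zero ((hω.contDiff_coord k).partialC2 i) (fun j => ?_) x y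
  funext z
  refine eq_zero_of_symm_of_antisymm
    (S := fun i j k => partialC2 i (partialC2 j (fun x => coordC2 k (ω x))) z)
    (fun i j k => congrFun (partialC2_comm (hω.contDiff_coord k) i j) z) (fun i j k => ?_) j i k
  have h := congrFun (hω.partialC2_strain i j k) z
  have h0 : partialC2 i (conformalFactorC2 ω) z = 0 := by simp [partialC2, hφ]
  simpa [h0] using h

end IsConformalKillingC2

/-- The diagonal map `(z₁, z₂) ↦ (a z₁, b z₂)` of `ℂ²`. -/
noncomputable def diagC2 (a b : ℂ) : ℂ × ℂ →L[ℝ] ℂ × ℂ :=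
  (ContinuousLinearMap.mul ℝ ℂ a).prodMap (ContinuousLinearMap.mul ℝ ℂ b)

@[simp]
lemma diagC2_apply (a b : ℂ) (z : ℂ × ℂ) : diagC2 a b z = (a * z.1, b * z.2) := rfl

section Equivariant

variable {ω : ℂ × ℂ → ℂ × ℂ} {ζ ξ : ℂ}

lemma fderiv_diagC2_of_equivariant (hω : Differentiable ℝ ω)
    (h : ∀ z, ω (diagC2 ζ ξ z) = diagC2 ζ ξ (ω z)) (x v : ℂ × ℂ) :
    fderiv ℝ ω (diagC2 ζ ξ x) (diagC2 ζ ξ v) = diagC2 ζ ξ (fderiv ℝ ω x v) := by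
  have h1 := (hω (diagC2 ζ ξ x)).hasFDerivAt.comp x (diagC2 ζ ξ).hasFDerivAt
  have h2 := (diagC2 ζ ξ).hasFDerivAt.comp x (hω x).hasFDerivAt
  have h3 : ω ∘ diagC2 ζ ξ = diagC2 ζ ξ ∘ ω := funext h
  rw [h3] at h1
  exact congrArg (fun L => L v) (h1.unique h2)

/-- The conformal factor of an equivariant conformal Killing field is invariant. -/
lemma IsConformalKillingC2.conformalFactorC2_diagC2 (hω : IsConformalKillingC2 ω)
    (hζ : ζ.re ^ 2 + ζ.im ^ 2 = 1)
    (h : ∀ z, ω (diagC2 ζ ξ z) = diagC2 ζ ξ (ω z)) (x : ℂ × ℂ) :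
    conformalFactorC2 ω (diagC2 ζ ξ x) = conformalFactorC2 ω x := by
  have h1 := fderiv_diagC2_of_equivariant (hω.1.differentiable (by simp)) h x (1, 0)
  have e : diagC2 ζ ξ (1, 0) = ζ.re • stdBasisC2 0 + ζ.im • stdBasisC2 1 := by
    apply ext_coordC2
    intro k
    fin_cases k <;> simp [coordC2, stdBasisC2]
  rw [e, map_add, map_smul, map_smul] at h1
  have h00 := hω.strain_apply (diagC2 ζ ξ x) 0 0
  have h01 := hω.strain_apply (diagC2 ζ ξ x) 0 1
  have h11 := hω.strain_apply (diagC2 ζ ξ x) 1 1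
  have hx := hω.strain_apply x 0 0
  have hre := congrArg (fun v => v.1.re) h1
  have him := congrArg (fun v => v.1.im) h1
  simp only [coordC2, stdBasisC2, Fin.isValue, Matrix.cons_val, diagC2_apply, Prod.fst_add,
    Prod.smul_fst, Complex.add_re, Complex.add_im, Complex.real_smul, Complex.mul_re,
    Complex.mul_im, Complex.ofReal_re, Complex.ofReal_im, if_true, zero_mul, sub_zero,
    add_zero, zero_ne_one, if_false] at h00 h01 h11 hx hre him
  rw [diagC2_apply]
  linear_combination ζ.re * hre + ζ.im * him - ζ.re ^ 2 / 2 * h00 - ζ.im ^ 2 / 2 * h11 -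
    ζ.re * ζ.im * h01 + hx / 2 +
    ((fderiv ℝ ω x (1, 0)).1.re - conformalFactorC2 ω (ζ * x.1, ξ * x.2)) * hζ

lemma exists_diagC2_sub (hζ : ζ ≠ 1) (hξ : ξ ≠ 1) (v : ℂ × ℂ) :
    ∃ w, diagC2 ζ ξ w - w = v := by
  have h1 := sub_ne_zero.2 hζ
  have h2 := sub_ne_zero.2 hξ
  refine ⟨(v.1 / (ζ - 1), v.2 / (ξ - 1)), Prod.ext ?_ ?_⟩
  · simp only [diagC2_apply, Prod.fst_sub]; field_simp
  · simp only [diagC2_apply, Prod.snd_sub]; field_simp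

/-- A conformal Killing field equivariant under a rotation without fixed vectors is linear. -/
lemma IsConformalKillingC2.eq_fderiv_of_equivariant (hω : IsConformalKillingC2 ω)
    (hζ : ζ.re ^ 2 + ζ.im ^ 2 = 1) (hζ1 : ζ ≠ 1) (hξ1 : ξ ≠ 1)
    (h : ∀ z, ω (diagC2 ζ ξ z) = diagC2 ζ ξ (ω z)) (x : ℂ × ℂ) :
    ω x = fderiv ℝ ω 0 x := by
  have hφ (y : ℂ × ℂ) : fderiv ℝ (conformalFactorC2 ω) y = 0 := by
    have hd : Differentiable ℝ (conformalFactorC2 ω) :=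
      hω.contDiff_conformalFactorC2.differentiable (by simp)
    have h1 := (hd (diagC2 ζ ξ y)).hasFDerivAt.comp y (diagC2 ζ ξ).hasFDerivAt
    have h3 : conformalFactorC2 ω ∘ diagC2 ζ ξ = conformalFactorC2 ω :=
      funext (hω.conformalFactorC2_diagC2 hζ h)
    rw [h3, hω.fderiv_conformalFactorC2_eq _ y] at h1
    have h4 := h1.unique (hd y).hasFDerivAt
    refine ContinuousLinearMap.ext fun v => ?_
    obtain ⟨w, rfl⟩ := exists_diagC2_sub hζ1 hξ1 v
    have h5 := congrArg (fun L => L w) h4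
    rw [map_sub]
    exact sub_eq_zero.2 h5
  have h0 : ω 0 = 0 := by
    have h1 := h 0
    rw [map_zero] at h1
    refine Prod.ext ?_ ?_
    · have h2 : (ω 0).1 = ζ * (ω 0).1 := congrArg Prod.fst h1
      exact (mul_eq_zero.1 (show (ζ - 1) * (ω 0).1 = 0 by linear_combination -h2)).resolve_left
        (sub_ne_zero.2 hζ1)
    · have h2 : (ω 0).2 = ξ * (ω 0).2 := congrArg Prod.snd h1
      exact (mul_eq_zero.1 (show (ξ - 1) * (ω 0).2 = 0 by linear_combination -h2)).resolve_left
        (sub_ne_zero.2 hξ1)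
  have hd : Differentiable ℝ ω := hω.1.differentiable (by simp)
  have hc := is_const_of_fderiv_eq_zero (𝕜 := ℝ) (f := ω - ⇑(fderiv ℝ ω 0))
    (hd.sub (fderiv ℝ ω 0).differentiable) (fun y => by
      rw [((hd y).hasFDerivAt.sub (fderiv ℝ ω 0).hasFDerivAt).fderiv, hω.fderiv_eq hφ y 0,
        sub_self]) x 0
  simpa [h0, sub_eq_zero] using hc

end Equivariant

/-- The linear vector fields given by `ℝ ⊕ 𝔲(2)`, acting complex linearly in `(z₁, z̄₂)`. -/
noncomputable def unitaryFieldC2 (p : ℝ × ℝ × ℝ × ℂ) : ℂ × ℂ →ₗ[ℝ] ℂ × ℂ where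
  toFun z := (⟨p.1, p.2.1⟩ * z.1 + p.2.2.2 * star z.2, -p.2.2.2 * star z.1 + ⟨p.1, p.2.2.1⟩ * z.2)
  map_add' z w := by ext <;> simp <;> ring
  map_smul' c z := by ext <;> simp <;> ring

lemma unitaryFieldC2_apply (p : ℝ × ℝ × ℝ × ℂ) (z : ℂ × ℂ) : unitaryFieldC2 p z =
    (⟨p.1, p.2.1⟩ * z.1 + p.2.2.2 * star z.2, -p.2.2.2 * star z.1 + ⟨p.1, p.2.2.1⟩ * z.2) := rfl

/-- The parametrization of the linear fields from `ℝ ⊕ 𝔲(2)`. -/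
noncomputable def unitaryFieldC2Hom : ℝ × ℝ × ℝ × ℂ →ₗ[ℝ] (ℂ × ℂ → ℂ × ℂ) where
  toFun p := unitaryFieldC2 p
  map_add' p q := by
    funext z
    refine Prod.ext (Complex.ext ?_ ?_) (Complex.ext ?_ ?_) <;>
      simp [unitaryFieldC2_apply] <;> ring
  map_smul' c p := by
    funext z
    refine Prod.ext (Complex.ext ?_ ?_) (Complex.ext ?_ ?_) <;>
      simp [unitaryFieldC2_apply] <;> ring

lemma unitaryFieldC2Hom_injective : Function.Injective unitaryFieldC2Hom := by
  intro p q h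
  have h1 : unitaryFieldC2 p (1, 0) = unitaryFieldC2 q (1, 0) := congrFun h _
  have h2 : unitaryFieldC2 p (0, 1) = unitaryFieldC2 q (0, 1) := congrFun h _
  simp only [unitaryFieldC2_apply, Prod.mk.injEq, star_one, star_zero, mul_one, mul_zero,
    add_zero, zero_add, Complex.mk.injEq] at h1 h2
  exact Prod.ext h1.1.1 (Prod.ext h1.1.2 (Prod.ext h2.2.2 h2.1))

lemma isConformalKillingC2_unitaryFieldC2 (p : ℝ × ℝ × ℝ × ℂ) :
    IsConformalKillingC2 (unitaryFieldC2 p) := by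
  have hL : (unitaryFieldC2 p : ℂ × ℂ → ℂ × ℂ) =
    (unitaryFieldC2 p).toContinuousLinearMap := rfl
  constructor
  · rw [hL]
    exact ContinuousLinearMap.contDiff _
  · intro x i j
    rw [hL, ContinuousLinearMap.fderiv]
    simp only [LinearMap.coe_toContinuousLinearMap', unitaryFieldC2_apply]
    fin_cases i <;> fin_cases j <;> simp [coordC2, stdBasisC2, Fin.sum_univ_four] <;> ring

/-- A linear conformal Killing field commuting with a non-real diagonal rotation lies in
`ℝ ⊕ 𝔲(2)`. -/
lemma IsConformalKillingC2.exists_eq_unitaryFieldC2 {L : ℂ × ℂ →L[ℝ] ℂ × ℂ}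
    (hL : IsConformalKillingC2 L) {ζ : ℂ} (hζ : ζ.im ≠ 0)
    (h : ∀ z, L (diagC2 ζ (star ζ) z) = diagC2 ζ (star ζ) (L z)) :
    ∃ p, unitaryFieldC2 p = (L : ℂ × ℂ →ₗ[ℝ] ℂ × ℂ) := by
  have hJ (z : ℂ × ℂ) : L (diagC2 Complex.I (-Complex.I) z) =
      diagC2 Complex.I (-Complex.I) (L z) := by
    have e (z : ℂ × ℂ) : diagC2 ζ (star ζ) z =
        ζ.re • z + ζ.im • diagC2 Complex.I (-Complex.I) z := by
      refine Prod.ext (Complex.ext ?_ ?_) (Complex.ext ?_ ?_) <;> simp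
      ring
    have h1 := h z
    rw [e, e, map_add, map_smul, map_smul] at h1
    exact smul_right_injective _ hζ (add_left_cancel h1)
  have h1 : L (Complex.I, 0) = (Complex.I * (L (1, 0)).1, -Complex.I * (L (1, 0)).2) := by
    simpa using hJ (1, 0)
  have h3 : L (0, Complex.I) = (-Complex.I * (L (0, 1)).1, Complex.I * (L (0, 1)).2) := by
    have h4 := hJ (0, 1)
    have h5 : diagC2 Complex.I (-Complex.I) (0, 1) = -(0, Complex.I) := by simp
    rw [h5, map_neg, neg_eq_iff_eq_neg] at h4
    simpa using h4
  have k00 := hL.strain_apply 0 0 0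
  have k22 := hL.strain_apply 0 2 2
  have k02 := hL.strain_apply 0 0 2
  have k03 := hL.strain_apply 0 0 3
  rw [ContinuousLinearMap.fderiv] at k00 k22 k02 k03
  simp [coordC2, stdBasisC2, h3] at k00 k22 k02 k03
  refine ⟨((L (1, 0)).1.re, (L (1, 0)).1.im, (L (0, 1)).2.im, (L (0, 1)).1), ?_⟩
  refine LinearMap.ext fun z => ?_
  have hz : L z = z.1.re • L (1, 0) + z.1.im • L (Complex.I, 0) + z.2.re • L (0, 1) +
      z.2.im • L (0, Complex.I) := by
    conv_lhs => rw [← sum_coordC2_smul_stdBasisC2 z]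
    simp only [Fin.sum_univ_four, map_add, map_smul]
    rfl
  rw [ContinuousLinearMap.coe_coe, hz, h1, h3]
  apply ext_coordC2
  intro k
  fin_cases k <;> simp [coordC2, unitaryFieldC2_apply]
  · ring
  · ring
  · linear_combination -z.1.re * k02 - z.1.im * k03 + z.2.re * (k00 - k22) / 2
  · linear_combination -z.1.re * k03 + z.1.im * k02 + z.2.im * (k00 - k22) / 2

/-- For `n ≥ 2`, `ζ = exp(2πi/(n+1))` and `γ(z₁,z₂) = (ζz₁, ζ⁻¹z₂)` the generator of
the type `Aₙ` action on `ℂ² ≅ ℝ⁴`, the space of conformal Killing fields on Euclidean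
`ℝ⁴` equivariant under `γ` has dimension 5.  This is `dim H⁰(ℝ⁴/Γ) = 4 + 1` for `Γ`
of type `Aₙ`, `n ≥ 2`. -/
theorem conformal_killing_fields_typeA_equivariant_dim_5
    (n : ℕ) (hn : 2 ≤ n)
    (ζ : ℂ) (hζ : ζ = Complex.exp (2 * Real.pi * Complex.I / (n + 1)))
    (γ : ℂ × ℂ → ℂ × ℂ) (hγ : ∀ z : ℂ × ℂ, γ z = (ζ * z.1, ζ⁻¹ * z.2)) :
    ∃ V : Submodule ℝ (ℂ × ℂ → ℂ × ℂ),
      (∀ ω, ω ∈ V ↔ (IsConformalKillingC2 ω ∧ ∀ z, ω (γ z) = γ (ω z))) ∧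
      Module.finrank ℝ V = 5 := by
  have harg : ζ = Complex.exp ((2 * Real.pi / (n + 1) : ℝ) * Complex.I) := by
    rw [hζ]
    congr 1
    push_cast
    ring
  have hn' : (2 : ℝ) ≤ n := by exact_mod_cast hn
  have him : ζ.im ≠ 0 := by
    rw [harg, Complex.exp_ofReal_mul_I_im]
    refine (Real.sin_pos_of_pos_of_lt_pi (by positivity) ?_).ne'
    rw [div_lt_iff₀ (by positivity)]
    nlinarith [Real.pi_pos]
  have hnorm : ζ.re ^ 2 + ζ.im ^ 2 = 1 := by
    rw [harg, Complex.exp_ofReal_mul_I_re, Complex.exp_ofReal_mul_I_im, Real.cos_sq_add_sin_sq]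
  have hinv : ζ⁻¹ = star ζ := by
    rw [Complex.inv_def, Complex.normSq_apply, ← sq, ← sq, hnorm]
    simp
  obtain rfl : γ = diagC2 ζ (star ζ) := by
    funext z
    rw [hγ, hinv, diagC2_apply]
  have hζ1 : ζ ≠ 1 := fun h => him (by simp [h])
  have hξ1 : star ζ ≠ 1 := fun h => hζ1 (by simpa using congrArg star h)
  refine ⟨LinearMap.range unitaryFieldC2Hom, fun ω => ⟨?_, fun ⟨hω, h⟩ => ?_⟩, ?_⟩
  · rintro ⟨p, rfl⟩
    refine ⟨isConformalKillingC2_unitaryFieldC2 p, fun z => ?_⟩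
    change unitaryFieldC2 p _ = diagC2 _ _ (unitaryFieldC2 p z)
    simp only [unitaryFieldC2_apply, diagC2_apply, star_mul', star_star]
    ext1 <;> ring
  · have hlin : ω = fderiv ℝ ω 0 := funext (hω.eq_fderiv_of_equivariant hnorm hζ1 hξ1 h)
    generalize fderiv ℝ ω 0 = L at hlin
    subst hlin
    obtain ⟨p, hp⟩ := hω.exists_eq_unitaryFieldC2 him h
    exact ⟨p, congrArg (fun M : ℂ × ℂ →ₗ[ℝ] ℂ × ℂ => (M : ℂ × ℂ → ℂ × ℂ)) hp⟩
  · rw [LinearMap.finrank_range_of_inj unitaryFieldC2Hom_injective]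
    simp
end

section
/- Fix m ≥ 2 and let Γ be the binary dihedral subgroup of the unit quaternions generated by cos(π/m) + sin(π/m)·i and j, acting on ℍ ≅ ℝ⁴ by left multiplication. Then the space of conformal Killing fields ω on Euclidean ℝ⁴ satisfying ω(γx) = γ(ω(x)) for all x ∈ ℝ⁴ and all γ ∈ Γ has dimension 4. (This is the dimension dim H⁰(ℝ⁴/Γ) = 3 + 1 for Γ of type D_n with n = m + 2 ≥ 4.) -/
open Quaternion Metric

/-- The standard real basis `1, i, j, k` of `ℍ ≅ ℝ⁴`. -/
def stdBasisH : Fin 4 → ℍ[ℝ] :=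
  ![⟨1, 0, 0, 0⟩, ⟨0, 1, 0, 0⟩, ⟨0, 0, 1, 0⟩, ⟨0, 0, 0, 1⟩]

/-- The real coordinates of a quaternion with respect to the basis `1, i, j, k`. -/
def coordH (k : Fin 4) (v : ℍ[ℝ]) : ℝ :=
  ![v.re, v.imI, v.imJ, v.imK] k

/-- A conformal Killing field on Euclidean `ℝ⁴ ≅ ℍ`: a smooth vector field
`ω` with `∂ᵢωⱼ + ∂ⱼωᵢ − (1/2)(div ω)·δᵢⱼ = 0` for all `i, j`. -/
def IsConformalKillingH (ω : ℍ[ℝ] → ℍ[ℝ]) : Prop :=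
  ContDiff ℝ (⊤ : ℕ∞) ω ∧
    ∀ (x : ℍ[ℝ]) (i j : Fin 4),
      coordH j ((fderiv ℝ ω x) (stdBasisH i)) +
        coordH i ((fderiv ℝ ω x) (stdBasisH j)) =
      (1 / 2) * (∑ k : Fin 4, coordH k ((fderiv ℝ ω x) (stdBasisH k))) *
        (if i = j then 1 else 0)

theorem eq_zero_of_eq_neg {V : Type*} [AddCommGroup V] [Module ℝ V] {v : V} (h : v = -v) :
    v = 0 := by
  have h2 : (2 : ℝ) • v = 0 := by rw [two_smul]; exact eq_neg_iff_add_eq_zero.1 h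
  simpa using h2

/-- A linear constraint satisfied by a function is satisfied by its derivatives. -/
theorem clm_fderiv_eq_zero {E F G : Type*} [NormedAddCommGroup E] [NormedSpace ℝ E]
    [NormedAddCommGroup F] [NormedSpace ℝ F] [NormedAddCommGroup G] [NormedSpace ℝ G]
    {f : E → F} (hf : Differentiable ℝ f) (Φ : F →L[ℝ] G) (h : ∀ x, Φ (f x) = 0) (x v : E) :
    Φ (fderiv ℝ f x v) = 0 := by
  have h1 : HasFDerivAt (fun x => Φ (f x)) (Φ.comp (fderiv ℝ f x)) x :=
    Φ.hasFDerivAt.comp x (hf x).hasFDerivAt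
  have h2 : (fun x => Φ (f x)) = fun _ => 0 := funext h
  rw [h2] at h1
  simpa using congr($(h1.unique (hasFDerivAt_const 0 x)) v)

theorem fderiv_comp_neg {E F : Type*} [NormedAddCommGroup E] [NormedSpace ℝ E]
    [NormedAddCommGroup F] [NormedSpace ℝ F] {f : E → F} (hf : Differentiable ℝ f) (x : E) :
    fderiv ℝ (fun y => f (-y)) x = -fderiv ℝ f (-x) := by
  have h := (hf (-x)).hasFDerivAt.comp x (hasFDerivAt_id (𝕜 := ℝ) x).neg
  refine h.fderiv.trans ?_
  ext v
  simp

/-- The third prolongation of the conformal algebra vanishes in dimension four. -/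
theorem third_prolongation_eq_zero (t : Fin 4 → Fin 4 → Fin 4 → Fin 4 → ℝ)
    (F : Fin 4 → Fin 4 → ℝ) (h12 : ∀ l i j k, t l i j k = t i l j k)
    (h23 : ∀ l i j k, t l i j k = t l j i k)
    (hF : ∀ l i j k, t l i j k + t l i k j = F l i * (if j = k then 1 else 0))
    (l i j k : Fin 4) : t l i j k = 0 := by
  have key : ∀ l i j k, 2 * t l i j k = F l i * (if j = k then 1 else 0) +
      F l j * (if i = k then 1 else 0) - F l k * (if i = j then 1 else 0) := by
    intro l i j k
    have e1 := hF l i j k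
    have e2 := hF l j i k
    have e3 := hF l k i j
    linarith [h23 l i j k, h23 l i k j, h23 l j k i]
  have compat : ∀ l i j k, F l i * (if j = k then 1 else 0) +
      F l j * (if i = k then 1 else 0) - F l k * (if i = j then 1 else 0) =
      F i l * (if j = k then 1 else 0) +
      F i j * (if l = k then 1 else 0) - F i k * (if l = j then 1 else 0) := by
    intro l i j k
    rw [← key, ← key, h12]
  have hoff : ∀ l j, l ≠ j → F l j = 0 := by
    intro l j hlj
    obtain ⟨i, hi, hi'⟩ : ∃ i : Fin 4, i ≠ l ∧ i ≠ j := by revert l j; decide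
    have e := compat l i j i
    simp only [hi'.symm, hi', hi.symm, hlj, if_true, if_false] at e
    linarith
  have hdiag : ∀ l i, l ≠ i → F l l = -F i i := by
    intro l i hli
    have e := compat l i l i
    simp only [hli, hli.symm, if_true, if_false] at e
    linarith
  have hFz : ∀ l j, F l j = 0 := by
    intro l j
    by_cases hlj : l = j
    · subst hlj
      obtain ⟨p, q, hp, hq, hpq⟩ : ∃ p q : Fin 4, l ≠ p ∧ l ≠ q ∧ p ≠ q := by revert l; decide
      linarith [hdiag l p hp, hdiag l q hq, hdiag p q hpq]
    · exact hoff l j hlj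
  have e := key l i j k
  simp only [hFz] at e
  linarith

section ConformalKilling

variable {E : Type*} [NormedAddCommGroup E] [NormedSpace ℝ E]

theorem Module.Basis.clm_eq_zero {ι F : Type*} [NormedAddCommGroup F] [NormedSpace ℝ F]
    (b : Module.Basis ι ℝ E) {L : E →L[ℝ] F} (h : ∀ i, L (b i) = 0) : L = 0 :=
  ContinuousLinearMap.coe_injective (b.ext h)

/-- The equations cutting out the infinitesimally conformal endomorphisms of a vector space
whose Euclidean structure makes the basis `b` orthonormal. -/
noncomputable def conformalDefect (b : Module.Basis (Fin 4) ℝ E) (i j : Fin 4) :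
    (E →L[ℝ] E) →L[ℝ] ℝ :=
  have := b.finiteDimensional_of_finite
  let c (k l : Fin 4) : (E →L[ℝ] E) →L[ℝ] ℝ :=
    (LinearMap.toContinuousLinearMap (b.coord k)).comp (ContinuousLinearMap.apply ℝ E (b l))
  c j i + c i j - ((1 / 2) * (if i = j then 1 else 0) : ℝ) • ∑ k, c k k

theorem conformalDefect_eq_zero_iff (b : Module.Basis (Fin 4) ℝ E) (i j : Fin 4) (A : E →L[ℝ] E) :
    conformalDefect b i j A = 0 ↔
      b.coord j (A (b i)) + b.coord i (A (b j)) =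
        (1 / 2) * (∑ k, b.coord k (A (b k))) * (if i = j then 1 else 0) := by
  rw [mul_right_comm, ← sub_eq_zero (a := b.coord j _ + _)]
  by_cases hij : i = j <;> simp [conformalDefect, hij]

/-- An odd conformal Killing field on `ℝ⁴` is linear. -/
theorem eq_fderiv_zero_of_conformal_of_odd (b : Module.Basis (Fin 4) ℝ E) {ω : E → E}
    (hs : ContDiff ℝ (⊤ : ℕ∞) ω)
    (hc : ∀ x i j, b.coord j (fderiv ℝ ω x (b i)) + b.coord i (fderiv ℝ ω x (b j)) =
      (1 / 2) * (∑ k, b.coord k (fderiv ℝ ω x (b k))) * (if i = j then 1 else 0))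
    (hodd : ∀ x, ω (-x) = -ω x) (x : E) : ω x = fderiv ℝ ω 0 x := by
  have h2 : minSmoothness ℝ 2 ≤ ((⊤ : ℕ∞) : WithTop ℕ∞) := by
    rw [minSmoothness_of_isRCLikeNormedField]
    exact WithTop.coe_le_coe.2 (le_top : (2 : ℕ∞) ≤ ⊤)
  have hs1 : ContDiff ℝ (⊤ : ℕ∞) (fderiv ℝ ω) := hs.fderiv_right (by simp)
  have hs2 : ContDiff ℝ (⊤ : ℕ∞) (fderiv ℝ (fderiv ℝ ω)) := hs1.fderiv_right (by simp)
  have hd0 : Differentiable ℝ ω := hs.differentiable (by simp)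
  have hd1 : Differentiable ℝ (fderiv ℝ ω) := hs1.differentiable (by simp)
  have hd2 : Differentiable ℝ (fderiv ℝ (fderiv ℝ ω)) := hs2.differentiable (by simp)
  have symm2 : ∀ x u v, fderiv ℝ (fderiv ℝ ω) x u v = fderiv ℝ (fderiv ℝ ω) x v u :=
    fun x u v => (hs.contDiffAt.isSymmSndFDerivAt h2).eq u v
  have symm3 : ∀ x u v, fderiv ℝ (fderiv ℝ (fderiv ℝ ω)) x u v =
      fderiv ℝ (fderiv ℝ (fderiv ℝ ω)) x v u :=
    fun x u v => (hs1.contDiffAt.isSymmSndFDerivAt h2).eq u v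
  have symm3' : ∀ x u v w, fderiv ℝ (fderiv ℝ (fderiv ℝ ω)) x u v w =
      fderiv ℝ (fderiv ℝ (fderiv ℝ ω)) x u w v := by
    intro x u v w
    have e := clm_fderiv_eq_zero hd2
      ((ContinuousLinearMap.apply ℝ E w).comp (ContinuousLinearMap.apply ℝ (E →L[ℝ] E) v) -
        (ContinuousLinearMap.apply ℝ E v).comp (ContinuousLinearMap.apply ℝ (E →L[ℝ] E) w))
      (fun y => by simp [symm2 y v w]) x u
    simpa [sub_eq_zero] using e
  have hΦ1 : ∀ i j x, conformalDefect b i j (fderiv ℝ ω x) = 0 :=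
    fun i j x => (conformalDefect_eq_zero_iff b i j _).2 (hc x i j)
  have hΦ2 : ∀ i j x u, conformalDefect b i j (fderiv ℝ (fderiv ℝ ω) x u) = 0 :=
    fun i j => clm_fderiv_eq_zero hd1 _ (hΦ1 i j)
  have hΦ3 : ∀ i j x u v,
      conformalDefect b i j (fderiv ℝ (fderiv ℝ (fderiv ℝ ω)) x u v) = 0 :=
    fun i j x u v => clm_fderiv_eq_zero hd2
      ((conformalDefect b i j).comp (ContinuousLinearMap.apply ℝ _ v))
      (fun y => hΦ2 i j y v) x u
  have hD3 : ∀ x, fderiv ℝ (fderiv ℝ (fderiv ℝ ω)) x = 0 := by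
    intro x
    refine b.clm_eq_zero fun l => b.clm_eq_zero fun i =>
      b.clm_eq_zero fun j => b.forall_coord_eq_zero_iff.1 fun k => ?_
    refine third_prolongation_eq_zero
      (fun l i j k => b.coord k (fderiv ℝ (fderiv ℝ (fderiv ℝ ω)) x
        (b l) (b i) (b j)))
      (fun l i => (1 / 2) * ∑ k, b.coord k (fderiv ℝ (fderiv ℝ (fderiv ℝ ω)) x
        (b l) (b i) (b k))) ?_ ?_ ?_ l i j k
    · intro l i j k
      simp only [symm3 x (b l) (b i)]
    · intro l i j k
      simp only [symm3' x (b l) (b i) (b j)]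
    · intro l i j k
      exact (conformalDefect_eq_zero_iff b j k _).1 (hΦ3 j k x _ _)
  have even1 : ∀ x, fderiv ℝ ω (-x) = fderiv ℝ ω x := by
    intro x
    have e := fderiv_comp_neg hd0 x
    simp only [hodd, fderiv_fun_neg] at e
    exact (neg_injective e).symm
  have odd2 : ∀ x, fderiv ℝ (fderiv ℝ ω) (-x) = -fderiv ℝ (fderiv ℝ ω) x := by
    intro x
    have e := fderiv_comp_neg hd1 x
    simp only [even1] at e
    rw [e, neg_neg]
  have hD2 : ∀ x, fderiv ℝ (fderiv ℝ ω) x = 0 := by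
    intro x
    have e := is_const_of_fderiv_eq_zero hd2 hD3 (-x) x
    rw [odd2] at e
    exact eq_zero_of_eq_neg e.symm
  have hD1 : ∀ x, fderiv ℝ ω x = fderiv ℝ ω 0 :=
    fun x => is_const_of_fderiv_eq_zero hd1 hD2 x 0
  have hω0 : ω 0 = 0 := by
    have e := hodd 0
    rw [neg_zero] at e
    exact eq_zero_of_eq_neg e
  have hconst := is_const_of_fderiv_eq_zero (𝕜 := ℝ) (f := fun y => ω y - fderiv ℝ ω 0 y)
    (hd0.sub (fderiv ℝ ω 0).differentiable)
    (fun y => by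
      rw [fderiv_fun_sub (hd0 y) (fderiv ℝ ω 0).differentiableAt, ContinuousLinearMap.fderiv,
        hD1 y, sub_self]) x 0
  simpa [hω0, sub_eq_zero] using hconst

end ConformalKilling

@[simp] theorem coordH_zero (v : ℍ[ℝ]) : coordH 0 v = v.re := rfl
@[simp] theorem coordH_one (v : ℍ[ℝ]) : coordH 1 v = v.imI := rfl
@[simp] theorem coordH_two (v : ℍ[ℝ]) : coordH 2 v = v.imJ := rfl
@[simp] theorem coordH_three (v : ℍ[ℝ]) : coordH 3 v = v.imK := rfl

@[simp]
theorem re_stdBasisH (i : Fin 4) : (stdBasisH i).re = if i = 0 then 1 else 0 := by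
  fin_cases i <;> rfl

@[simp]
theorem imI_stdBasisH (i : Fin 4) : (stdBasisH i).imI = if i = 1 then 1 else 0 := by
  fin_cases i <;> rfl

@[simp]
theorem imJ_stdBasisH (i : Fin 4) : (stdBasisH i).imJ = if i = 2 then 1 else 0 := by
  fin_cases i <;> rfl

@[simp]
theorem imK_stdBasisH (i : Fin 4) : (stdBasisH i).imK = if i = 3 then 1 else 0 := by
  fin_cases i <;> rfl

/-- The basis of `ℍ` with members `stdBasisH` and coordinates `coordH`. -/
noncomputable def basisH : Module.Basis (Fin 4) ℝ ℍ[ℝ] :=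
  .ofEquivFun
    { toFun := fun v k => coordH k v
      invFun := fun f => ∑ k, f k • stdBasisH k
      map_add' := fun v w => by ext k; fin_cases k <;> simp
      map_smul' := fun c v => by ext k; fin_cases k <;> simp
      left_inv := fun v => by ext <;> simp [Fin.sum_univ_four]
      right_inv := fun f => by ext k; fin_cases k <;> simp [Fin.sum_univ_four] }

@[simp]
theorem basisH_apply (i : Fin 4) : basisH i = stdBasisH i := by
  simp [basisH, Pi.single_apply]

@[simp]
theorem basisH_repr (v : ℍ[ℝ]) (k : Fin 4) : basisH.repr v k = coordH k v := rfl

theorem isConformalKillingH_mul_right (q : ℍ[ℝ]) : IsConformalKillingH fun x => x * q := by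
  refine ⟨contDiff_id.mul contDiff_const, fun x i j => ?_⟩
  have hd (v : ℍ[ℝ]) : fderiv ℝ (fun x : ℍ[ℝ] => x * q) x v = v * q :=
    congr($(((ContinuousLinearMap.mul ℝ ℍ[ℝ]).flip q).fderiv (x := x)) v)
  simp only [hd]
  fin_cases i <;> fin_cases j <;> simp [Fin.sum_univ_four] <;> ring

/-- Right multiplications, as a linear family of vector fields on `ℍ`. -/
noncomputable def mulRightField : ℍ[ℝ] →ₗ[ℝ] (ℍ[ℝ] → ℍ[ℝ]) where
  toFun q x := x * q
  map_add' p q := funext fun x => mul_add x p q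
  map_smul' c q := funext fun x => mul_smul_comm c x q

theorem mulRightField_injective : Function.Injective mulRightField := fun p q h => by
  simpa [mulRightField] using congrFun h 1

/-- An endomorphism of `ℍ` commuting with left multiplication by `j` and by a non-real complex
number is a right multiplication. -/
theorem eq_mul_right_of_commute (L : ℍ[ℝ] →ₗ[ℝ] ℍ[ℝ]) {a : ℍ[ℝ]} (haI : a.imI ≠ 0)
    (haJ : a.imJ = 0) (haK : a.imK = 0) (ha : ∀ x, L (a * x) = a * L x)
    (hj : ∀ x, L (stdBasisH 2 * x) = stdBasisH 2 * L x) (x : ℍ[ℝ]) : L x = x * L 1 := by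
  have hi (x : ℍ[ℝ]) : L (stdBasisH 1 * x) = stdBasisH 1 * L x := by
    have e : a = a.re • 1 + a.imI • stdBasisH 1 := by ext <;> simp [haJ, haK]
    have h := ha x
    rw [e, add_mul, add_mul, smul_mul_assoc, smul_mul_assoc, smul_mul_assoc, smul_mul_assoc,
      one_mul, one_mul, map_add, map_smul, map_smul] at h
    exact smul_right_injective _ haI (add_left_cancel h)
  have h0 : stdBasisH 0 = 1 := rfl
  have hk : stdBasisH 3 = stdBasisH 1 * stdBasisH 2 := by ext <;> simp
  have hi1 := hi 1
  have hj1 := hj 1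
  rw [mul_one] at hi1 hj1
  suffices h : L = LinearMap.mulRight ℝ (L 1) from congr($h x)
  refine basisH.ext fun n => ?_
  rw [basisH_apply, LinearMap.mulRight_apply]
  fin_cases n
  · change L (stdBasisH 0) = stdBasisH 0 * L 1
    rw [h0, one_mul]
  · exact hi1
  · exact hj1
  · change L (stdBasisH 3) = stdBasisH 3 * L 1
    rw [hk, hi, hj1, mul_assoc]

/-- For `m ≥ 2` and `Γ` the binary dihedral subgroup of the unit quaternions
generated by `cos(π/m) + sin(π/m)·i` and `j`, acting on `ℍ ≅ ℝ⁴` by left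
multiplication, the space of conformal Killing fields on Euclidean `ℝ⁴` equivariant
under `Γ` has dimension 4.  This is `dim H⁰(ℝ⁴/Γ) = 3 + 1` for `Γ` of type `Dₙ`,
`n = m + 2 ≥ 4`. -/
theorem conformal_killing_fields_binary_dihedral_equivariant_dim_4
    (m : ℕ) (hm : 2 ≤ m)
    (a j : sphere (0 : ℍ[ℝ]) 1)
    (ha : (a : ℍ[ℝ]) = ⟨Real.cos (Real.pi / m), Real.sin (Real.pi / m), 0, 0⟩)
    (hj : (j : ℍ[ℝ]) = ⟨0, 0, 1, 0⟩) :
    ∃ V : Submodule ℝ (ℍ[ℝ] → ℍ[ℝ]),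
      (∀ ω, ω ∈ V ↔ (IsConformalKillingH ω ∧
        ∀ γ ∈ Subgroup.closure {a, j}, ∀ x : ℍ[ℝ],
          ω ((γ : ℍ[ℝ]) * x) = (γ : ℍ[ℝ]) * ω x)) ∧
      Module.finrank ℝ V = 4 := by
  have hm0 : (0 : ℝ) < m := by exact_mod_cast (by lia : 0 < m)
  have hsin : Real.sin (Real.pi / m) ≠ 0 := by
    refine (Real.sin_pos_of_pos_of_lt_pi (by positivity) ?_).ne'
    exact div_lt_self Real.pi_pos (by exact_mod_cast (by lia : 1 < m))
  refine ⟨LinearMap.range mulRightField, fun ω => ⟨?_, ?_⟩, ?_⟩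
  · rintro ⟨q, rfl⟩
    exact ⟨isConformalKillingH_mul_right q, fun γ _ x => mul_assoc _ _ _⟩
  · rintro ⟨hω, hΓ⟩
    have hωa := hΓ a (Subgroup.subset_closure (by simp))
    have hωj := hΓ j (Subgroup.subset_closure (by simp))
    rw [show (j : ℍ[ℝ]) = stdBasisH 2 from hj] at hωj
    have hjj : stdBasisH 2 * stdBasisH 2 = -1 := by ext <;> simp
    have hodd : ∀ x, ω (-x) = -ω x := by
      intro x
      rw [← neg_one_mul, ← hjj, mul_assoc, hωj, hωj, ← mul_assoc, hjj, neg_one_mul]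
    have hlin : ∀ x, ω x = fderiv ℝ ω 0 x :=
      eq_fderiv_zero_of_conformal_of_odd basisH hω.1 (by simpa using hω.2) hodd
    refine ⟨fderiv ℝ ω 0 1, funext fun x => ?_⟩
    rw [hlin x]
    refine (eq_mul_right_of_commute (fderiv ℝ ω 0).toLinearMap (a := a) ?_ ?_ ?_
      (fun x => ?_) (fun x => ?_) x).symm
    · rwa [ha]
    · rw [ha]
    · rw [ha]
    · exact (hlin _).symm.trans ((hωa x).trans congr(a * $(hlin x)))
    · exact (hlin _).symm.trans ((hωj x).trans congr(stdBasisH 2 * $(hlin x)))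
  · rw [LinearMap.finrank_range_of_inj mulRightField_injective, Quaternion.finrank_eq_four]
end
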